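/- arXiv:1108.6228 — 4 statements merged into one kernel-verified Lean document; each statement's English description precedes it below -/
import Mathlib

section
/- Let α > 0. Then lim_{N→∞} N^{1/4} · exp((α − α·log α)·√N) · ∫₀^{√N} (1 − u/√N)^N · u^{α√N − 1} du = √(2π/α) · exp(−α²/2). -/
open Filter Topology MeasureTheory

lemma aux_h_bound (s : ℝ) : s ^ 2 / (4 * (1 + |s|)) ≤ Real.exp s - 1 - s := by
  rw [div_le_iff₀ (by positivity)]
  rcases le_or_gt 0 s with hs | hs
  · have h := Real.quadratic_le_exp_of_nonneg hs
    rw [abs_of_nonneg hs]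
    have h1 : s ^ 2 / 2 ≤ Real.exp s - 1 - s := by linarith
    have h2 : s ^ 2 / 2 * (4 * (1 + s)) ≤ (Real.exp s - 1 - s) * (4 * (1 + s)) := by gcongr
    have h3 : 0 ≤ s ^ 3 := by positivity
    nlinarith [sq_nonneg s]
  · rw [abs_of_neg hs]
    rcases le_or_gt (-2) s with h2 | h2
    · have h := Real.add_one_le_exp (s / 2)
      have he : Real.exp s = Real.exp (s / 2) ^ 2 := by
        rw [← Real.exp_nat_mul]; congr 1; push_cast; ring
      have h1 : s ^ 2 / 4 ≤ Real.exp s - 1 - s := by rw [he]; nlinarith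
      have h4 : s ^ 2 / 4 * (4 * (1 + -s)) ≤ (Real.exp s - 1 - s) * (4 * (1 + -s)) := by
        gcongr; linarith
      nlinarith [mul_nonneg (neg_nonneg.2 hs.le) (sq_nonneg s)]
    · have h1 : - 1 - s ≤ Real.exp s - 1 - s := by linarith [Real.exp_pos s]
      have h4 : (-1 - s) * (4 * (1 + -s)) ≤ (Real.exp s - 1 - s) * (4 * (1 + -s)) := by
        gcongr; linarith
      nlinarith

lemma aux_h_bound' {k : ℝ} (hk : 1 ≤ k) (t : ℝ) :
    (|t| - 1) / 4 ≤ k ^ 2 * (Real.exp (t / k) - 1 - t / k) := by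
  have hk0 : 0 < k := by linarith
  have h := mul_le_mul_of_nonneg_left (aux_h_bound (t / k)) (sq_nonneg k)
  refine le_trans ?_ h
  rw [abs_div, abs_of_pos hk0]
  have h1 : |t| / k ≤ |t| := div_le_self (abs_nonneg _) hk
  have h0 : 0 ≤ |t| / k := by positivity
  have e : k ^ 2 * ((t / k) ^ 2 / (4 * (1 + |t| / k))) = t ^ 2 / (4 * (1 + |t| / k)) := by
    field_simp
  rw [e, div_le_div_iff₀ (by norm_num) (by positivity)]
  rcases le_or_gt |t| 1 with h2 | h2
  · nlinarith [sq_nonneg t]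
  · have := sq_abs t
    nlinarith

noncomputable def auxE (α k t : ℝ) : ℝ :=
  k ^ 4 * Real.log (1 - α * Real.exp (t / k) / k ^ 2) + α * k ^ 2 + α * k ^ 2 * (t / k)

noncomputable def auxG (α k t : ℝ) : ℝ :=
  Set.indicator {t | α * Real.exp (t / k) < k ^ 2} (fun t => Real.exp (auxE α k t)) t

lemma aux_E_le {α k : ℝ} (hα : 0 < α) (hk : 1 ≤ k) (t : ℝ) (ht : α * Real.exp (t / k) < k ^ 2) :
    auxE α k t ≤ -α * ((|t| - 1) / 4) := by
  have hk0 : 0 < k := by linarith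
  have h1 := mul_le_mul_of_nonneg_left (aux_h_bound' hk t) hα.le
  have hy : 0 < 1 - α * Real.exp (t / k) / k ^ 2 := by
    rw [sub_pos, div_lt_one (by positivity)]; exact ht
  have h2 := mul_le_mul_of_nonneg_left (Real.log_le_sub_one_of_pos hy) (by positivity : 0 ≤ k ^ 4)
  have e : k ^ 4 * (1 - α * Real.exp (t / k) / k ^ 2 - 1) = - (k ^ 2 * α * Real.exp (t / k)) := by
    field_simp; ring
  unfold auxE
  rw [e] at h2
  nlinarith

lemma aux_integrable {α : ℝ} (hα : 0 < α) :
    Integrable (fun t : ℝ => Real.exp (-α * ((|t| - 1) / 4))) := by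
  rw [← integrableOn_univ, ← Set.Iic_union_Ioi (a := (0:ℝ))]
  refine IntegrableOn.union ?_ ?_
  · refine IntegrableOn.congr_fun ((integrableOn_exp_mul_Iic (a := α / 4) (by positivity) 0).const_mul
      (Real.exp (α / 4))) ?_ measurableSet_Iic
    intro t ht
    have ht : t ≤ 0 := ht
    simp only [abs_of_nonpos ht, ← Real.exp_add]
    congr 1; ring
  · refine IntegrableOn.congr_fun ((integrableOn_exp_mul_Ioi (a := -(α / 4)) (by linarith) 0).const_mul
      (Real.exp (α / 4))) ?_ measurableSet_Ioi
    intro t ht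
    have ht : 0 < t := ht
    simp only [abs_of_pos ht, ← Real.exp_add]
    congr 1; ring

lemma aux_tk (t : ℝ) : Tendsto (fun k : ℝ => t / k) atTop (𝓝 0) :=
  tendsto_const_nhds.div_atTop tendsto_id

lemma aux_h_lim (t : ℝ) :
    Tendsto (fun k : ℝ => k ^ 2 * (Real.exp (t / k) - 1 - t / k)) atTop (𝓝 (t ^ 2 / 2)) := by
  rw [tendsto_iff_dist_tendsto_zero]
  have hb : Tendsto (fun k : ℝ => |t| ^ 3 / k) atTop (𝓝 0) := aux_tk _
  refine squeeze_zero' (Eventually.of_forall fun _ => dist_nonneg) ?_ hb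
  filter_upwards [eventually_gt_atTop 0, eventually_ge_atTop |t|] with k hk hkt
  have h1 : |t / k| ≤ 1 := by rw [abs_div, abs_of_pos hk, div_le_one hk]; exact hkt
  have h := Real.exp_bound h1 (n := 3) (by norm_num)
  simp only [Finset.sum_range_succ, Finset.sum_range_zero, Nat.factorial] at h
  norm_num at h
  rw [Real.dist_eq]
  have e : k ^ 2 * (Real.exp (t / k) - 1 - t / k) - t ^ 2 / 2
      = k ^ 2 * (Real.exp (t / k) - (1 + t / k + (t / k) ^ 2 / 2)) := by
    field_simp; ring
  rw [e, abs_mul, abs_of_pos (by positivity : 0 < k ^ 2)]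
  have h2 : |Real.exp (t / k) - (1 + t / k + (t / k) ^ 2 / 2)| ≤ |t / k| ^ 3 := by
    refine h.trans ?_
    have : 0 ≤ |t / k| ^ 3 := by positivity
    linarith
  calc _ ≤ k ^ 2 * |t / k| ^ 3 := by gcongr
    _ = |t| ^ 3 / k := by rw [abs_div, abs_of_pos hk]; field_simp

lemma aux_x_lim (α t : ℝ) :
    Tendsto (fun k : ℝ => α * Real.exp (t / k)) atTop (𝓝 α) := by
  have := ((Real.continuous_exp.tendsto 0).comp (aux_tk t)).const_mul α
  simpa using this

lemma aux_ev (α t : ℝ) : ∀ᶠ k : ℝ in atTop, α * Real.exp (t / k) < k ^ 2 := by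
  filter_upwards [(aux_x_lim α t).eventually (gt_mem_nhds (lt_add_one α)),
    (tendsto_pow_atTop (two_ne_zero)).eventually_ge_atTop (α + 1)] with k h1 h2
  linarith

lemma aux_E_lim {α : ℝ} (hα : 0 < α) (t : ℝ) :
    Tendsto (fun k : ℝ => auxE α k t) atTop (𝓝 (-α ^ 2 / 2 + -(α / 2) * t ^ 2)) := by
  have hk2 : Tendsto (fun k : ℝ => k ^ 2) atTop atTop := tendsto_pow_atTop two_ne_zero
  have hy : Tendsto (fun k : ℝ => α * Real.exp (t / k) / k ^ 2) atTop (𝓝 0) :=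
    (aux_x_lim α t).div_atTop hk2
  have hlog : Tendsto (fun k : ℝ => k ^ 4 * (α * Real.exp (t / k) / k ^ 2
      + (α * Real.exp (t / k) / k ^ 2) ^ 2 / 2
      + Real.log (1 - α * Real.exp (t / k) / k ^ 2))) atTop (𝓝 0) := by
    have hb : Tendsto (fun k : ℝ => ((α * Real.exp (t / k)) ^ 3 / k ^ 2) /
        (1 - α * Real.exp (t / k) / k ^ 2)) atTop (𝓝 0) := by
      have := (((aux_x_lim α t).pow 3).div_atTop hk2).div (hy.const_sub 1) (by norm_num)
      rw [sub_zero, zero_div] at this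
      exact this
    refine squeeze_zero_norm' ?_ hb
    filter_upwards [eventually_gt_atTop 0, aux_ev α t] with k hk hx
    have hx0 : 0 < α * Real.exp (t / k) := by positivity
    generalize α * Real.exp (t / k) = x at *
    have hy0 : 0 < x / k ^ 2 := by positivity
    have hy1 : x / k ^ 2 < 1 := by rw [div_lt_one (by positivity)]; exact hx
    have h := Real.abs_log_sub_add_sum_range_le (x := x / k ^ 2)
      (by rwa [abs_of_pos hy0]) 2
    simp only [Finset.sum_range_succ, Finset.sum_range_zero] at h
    norm_num at h
    rw [abs_of_pos hy0] at h
    rw [Real.norm_eq_abs, abs_mul, abs_of_pos (by positivity : 0 < k ^ 4)]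
    have hp : 0 < 1 - x / k ^ 2 := by linarith
    calc _ ≤ k ^ 4 * ((x / k ^ 2) ^ 3 / (1 - x / k ^ 2)) := by gcongr
      _ = _ := by
        rw [← mul_div_assoc]; congr 1; field_simp
  have hsum := (hlog.sub (((aux_x_lim α t).pow 2).div_const 2)).sub ((aux_h_lim t).const_mul α)
  have e : (0 - α ^ 2 / 2 - α * (t ^ 2 / 2)) = -α ^ 2 / 2 + -(α / 2) * t ^ 2 := by ring
  rw [e] at hsum
  refine hsum.congr' ?_
  filter_upwards [eventually_gt_atTop 0] with k hk
  unfold auxE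
  field_simp
  ring

lemma aux_G_lim {α : ℝ} (hα : 0 < α) :
    Tendsto (fun k : ℝ => ∫ t, auxG α k t) atTop
      (𝓝 (Real.sqrt (2 * Real.pi / α) * Real.exp (-α ^ 2 / 2))) := by
  have hI : ∫ t : ℝ, Real.exp (-α ^ 2 / 2 + -(α / 2) * t ^ 2)
      = Real.sqrt (2 * Real.pi / α) * Real.exp (-α ^ 2 / 2) := by
    simp only [Real.exp_add]
    rw [integral_const_mul, integral_gaussian, mul_comm]
    congr 2; field_simp
  rw [← hI]
  refine tendsto_integral_filter_of_dominated_convergence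
    (fun t : ℝ => Real.exp (-α * ((|t| - 1) / 4))) ?_ ?_ (aux_integrable hα) ?_
  · refine Eventually.of_forall fun k => Measurable.aestronglyMeasurable ?_
    unfold auxG
    refine Measurable.indicator ?_ (measurableSet_lt (by fun_prop) (by fun_prop))
    unfold auxE
    fun_prop
  · filter_upwards [eventually_ge_atTop 1] with k hk
    refine Eventually.of_forall fun t => ?_
    unfold auxG
    by_cases ht : α * Real.exp (t / k) < k ^ 2
    · rw [Set.indicator_of_mem (by exact ht), Real.norm_eq_abs, abs_of_pos (Real.exp_pos _)]
      exact Real.exp_le_exp.2 (aux_E_le hα hk t ht)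
    · rw [Set.indicator_of_notMem (by exact ht), norm_zero]
      positivity
  · refine Eventually.of_forall fun t => ?_
    refine ((Real.continuous_exp.tendsto _).comp (aux_E_lim hα t)).congr' ?_
    filter_upwards [aux_ev α t] with k hk
    unfold auxG
    rw [Set.indicator_of_mem (by exact hk)]
    rfl

lemma aux_cov {α k : ℝ} (hα : 0 < α) (hk : 0 < k) (N : ℕ) (hN : (N : ℝ) = k ^ 4) :
    k * Real.exp ((α - α * Real.log α) * k ^ 2) *
      ∫ u in Set.Ioo (0:ℝ) (k ^ 2), (1 - u / k ^ 2) ^ N * u ^ (α * k ^ 2 - 1)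
    = ∫ t, auxG α k t := by
  have hms : MeasurableSet {t : ℝ | α * Real.exp (t / k) < k ^ 2} :=
    measurableSet_lt (by fun_prop) (by fun_prop)
  have himg : (fun t : ℝ => α * Real.exp (t / k)) '' {t : ℝ | α * Real.exp (t / k) < k ^ 2}
      = Set.Ioo (0:ℝ) (k ^ 2) := by
    ext u
    constructor
    · rintro ⟨t, ht, rfl⟩
      exact ⟨by positivity, ht⟩
    · rintro ⟨h0, h1⟩
      have e : α * Real.exp (k * Real.log (u / α) / k) = u := by
        rw [mul_div_cancel_left₀ _ hk.ne', Real.exp_log (by positivity)]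
        field_simp
      exact ⟨k * Real.log (u / α), by rw [Set.mem_ofPred_eq, e]; exact h1, e⟩
  have hcov := integral_image_eq_integral_abs_deriv_smul
    (f := fun t : ℝ => α * Real.exp (t / k)) (f' := fun t => α * (Real.exp (t / k) * (1 / k)))
    hms (fun t _ => ((((hasDerivAt_id t).div_const k).exp).const_mul α).hasDerivWithinAt)
    (fun a _ b _ hab => by
      have h1 : Real.exp (a / k) = Real.exp (b / k) := mul_left_cancel₀ hα.ne' hab
      have h2 := Real.exp_injective h1
      exact (div_left_inj' hk.ne').1 h2)
    (fun u => (1 - u / k ^ 2) ^ N * u ^ (α * k ^ 2 - 1))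
  rw [himg] at hcov
  rw [hcov, ← integral_const_mul]
  unfold auxG
  rw [integral_indicator hms]
  refine setIntegral_congr_fun hms fun t ht => ?_
  have ht : α * Real.exp (t / k) < k ^ 2 := ht
  have hx : 0 < α * Real.exp (t / k) := by positivity
  have hy : 0 < 1 - α * Real.exp (t / k) / k ^ 2 := by
    rw [sub_pos, div_lt_one (by positivity)]; exact ht
  have hlx : Real.log (α * Real.exp (t / k)) = Real.log α + t / k := by
    rw [Real.log_mul hα.ne' (Real.exp_pos _).ne', Real.log_exp]
  have hpow : (1 - α * Real.exp (t / k) / k ^ 2) ^ N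
      = Real.exp (k ^ 4 * Real.log (1 - α * Real.exp (t / k) / k ^ 2)) := by
    rw [← hN, Real.exp_nat_mul, Real.exp_log hy]
  have hab : |α * (Real.exp (t / k) * (1 / k))| = (1 / k) * (α * Real.exp (t / k)) := by
    rw [abs_of_pos (by positivity)]; ring
  have hr : (α * Real.exp (t / k)) * (α * Real.exp (t / k)) ^ (α * k ^ 2 - 1)
      = Real.exp ((Real.log α + t / k) * (α * k ^ 2)) := by
    rw [Real.rpow_sub_one hx.ne', Real.rpow_def_of_pos hx, hlx]
    field_simp
  simp only [smul_eq_mul]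
  rw [hab, hpow]
  calc _ = Real.exp ((α - α * Real.log α) * k ^ 2) *
        (Real.exp (k ^ 4 * Real.log (1 - α * Real.exp (t / k) / k ^ 2)) *
        ((α * Real.exp (t / k)) * (α * Real.exp (t / k)) ^ (α * k ^ 2 - 1))) := by
        field_simp
    _ = _ := by
      rw [hr, ← Real.exp_add, ← Real.exp_add]
      congr 1
      unfold auxE
      ring

/-- Laplace-method asymptotics for the numerator integral in the super-critical regime. -/
theorem supercritical_numerator_asymptotics (α : ℝ) (hα : 0 < α) :
    Tendsto (fun N : ℕ =>
        (N : ℝ) ^ ((1:ℝ)/4) * Real.exp ((α - α * Real.log α) * Real.sqrt N) *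
          ∫ u in Set.Ioo (0:ℝ) (Real.sqrt N),
            (1 - u / Real.sqrt N) ^ N * u ^ (α * Real.sqrt N - 1))
      atTop (𝓝 (Real.sqrt (2 * Real.pi / α) * Real.exp (-α ^ 2 / 2))) := by
  have hk : Tendsto (fun N : ℕ => (N : ℝ) ^ ((1:ℝ)/4)) atTop atTop :=
    (tendsto_rpow_atTop (by norm_num)).comp tendsto_natCast_atTop_atTop
  refine ((aux_G_lim hα).comp hk).congr' ?_
  filter_upwards [eventually_gt_atTop 0] with N hN
  have hN' : (0:ℝ) < N := by exact_mod_cast hN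
  have h2 : Real.sqrt N = ((N : ℝ) ^ ((1:ℝ)/4)) ^ 2 := by
    rw [Real.sqrt_eq_rpow, ← Real.rpow_mul_natCast hN'.le]; norm_num
  have h4 : (N : ℝ) = ((N : ℝ) ^ ((1:ℝ)/4)) ^ 4 := by
    rw [← Real.rpow_mul_natCast hN'.le]; norm_num
  rw [h2]
  exact (aux_cov hα (by positivity) N h4).symm
end

section
/- Let 0 < ν < η < 1, μ = 1 − ν, α > 0, and let (C_N) be a sequence of integers with 1 ≤ C_N ≤ N−1 and C_N = ηN + O(1). Set α_N = α·N·(1−ν)^N and define B_x = ∫₀¹ (1−u)^x (1+(ν/μ)u)^{N−x} u^{α_N−1} du, D_x = ∫₀¹ (1−u)^{N−x} (1+(μ/ν)u)^x u^{α_N−1} du, b_N = ν ∫₀¹ (1−u)^{C_N} (1+(ν/μ)u)^{N−C_N−1} u^{α_N} du, d_N = μ ∫₀¹ (1−u)^{N−C_N−1} (1+(μ/ν)u)^{C_N} u^{α_N} du. Then lim_{N→∞} (d_N·B_{C_N} + b_N·D_{C_N}) / (d_N·B_0 + b_N·D_0) = ν/(ν+α). -/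
open Filter Topology MeasureTheory Asymptotics

/-- Integrability of a continuous function times a power on the unit interval. -/
lemma aux_int (p : ℝ → ℝ) (hp : Continuous p) (s : ℝ) (hs : -1 < s) :
    IntegrableOn (fun u : ℝ => p u * u ^ s) (Set.Ioo (0:ℝ) 1) := by
  have h1 : IntervalIntegrable (fun u : ℝ => u ^ s) volume 0 1 :=
    intervalIntegral.intervalIntegrable_rpow' hs
  have h2 := h1.continuousOn_mul hp.continuousOn
  rw [intervalIntegrable_iff_integrableOn_Ioo_of_le zero_le_one] at h2
  exact h2

lemma aux_pow (s : ℝ) (hs : -1 < s) : ∫ u in Set.Ioo (0:ℝ) 1, u ^ s = 1 / (s + 1) := by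
  rw [← integral_Ioc_eq_integral_Ioo, ← intervalIntegral.integral_of_le zero_le_one,
    integral_rpow (Or.inl hs)]
  rw [Real.one_rpow, Real.zero_rpow (by linarith), sub_zero]

lemma aux_f_le (r u : ℝ) (hr : 0 < r) (hu : u ∈ Set.Ioo (0:ℝ) 1) (x y : ℕ) :
    (1 - u) ^ x * (1 + r * u) ^ y ≤ Real.exp (-((x - r * y) * u)) := by
  have h0 := hu.1
  have h1 := hu.2
  have hru : 0 < r * u := mul_pos hr h0
  calc (1 - u) ^ x * (1 + r * u) ^ y ≤ (Real.exp (-u)) ^ x * (Real.exp (r * u)) ^ y := by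
        have a1 : 1 - u ≤ Real.exp (-u) := by linarith [Real.add_one_le_exp (-u)]
        have a2 : 1 + r * u ≤ Real.exp (r * u) := by linarith [Real.add_one_le_exp (r * u)]
        have a0 : 0 ≤ 1 - u := by linarith
        gcongr
    _ = _ := by
        rw [← Real.exp_nat_mul, ← Real.exp_nat_mul, ← Real.exp_add]
        congr 1; ring

lemma aux_BC (r e : ℝ) (hr : 0 < r) (he : 0 < e) (x y : ℕ) (hxy : r * y ≤ x) :
    1 - e * x ≤ e * ∫ u in Set.Ioo (0:ℝ) 1, (1 - u) ^ x * (1 + r * u) ^ y * u ^ (e - 1) ∧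
    e * ∫ u in Set.Ioo (0:ℝ) 1, (1 - u) ^ x * (1 + r * u) ^ y * u ^ (e - 1) ≤ 1 := by
  have hI := aux_int (fun u => (1 - u) ^ x * (1 + r * u) ^ y) (by fun_prop) (e - 1) (by linarith)
  have hI1 := aux_int (fun u => 1) (by fun_prop) (e - 1) (by linarith)
  have hI2 := aux_int (fun u => (x:ℝ)) (by fun_prop) 0 (by linarith)
  have hv : ∫ u in Set.Ioo (0:ℝ) 1, (1:ℝ) * u ^ (e - 1) = 1 / e := by
    simp only [one_mul]
    rw [aux_pow _ (by linarith)]; simp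
  have hv2 : ∫ u in Set.Ioo (0:ℝ) 1, (x:ℝ) * u ^ (0:ℝ) = x := by
    rw [integral_const_mul, aux_pow _ (by linarith)]; simp
  constructor
  · have : ∫ u in Set.Ioo (0:ℝ) 1, ((1:ℝ) * u ^ (e - 1) - (x:ℝ) * u ^ (0:ℝ)) ≤
        ∫ u in Set.Ioo (0:ℝ) 1, (1 - u) ^ x * (1 + r * u) ^ y * u ^ (e - 1) := by
      refine setIntegral_mono_on (hI1.sub hI2) hI measurableSet_Ioo fun u hu => ?_
      have h0 := hu.1
      have h1 := hu.2
      have hp : u ^ (e - 1) = u ^ e / u := by rw [Real.rpow_sub h0, Real.rpow_one]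
      have hb : 1 + (x:ℝ) * (-u) ≤ (1 + (-u)) ^ x :=
        one_add_mul_le_pow (by linarith) x
      have h2 : 1 ≤ (1 + r * u) ^ y := one_le_pow₀ (by nlinarith [mul_pos hr h0])
      have h3 : (1 - u) ^ x ≤ (1 - u) ^ x * (1 + r * u) ^ y :=
        le_mul_of_one_le_right (pow_nonneg (by linarith) _) h2
      have h4 : 1 - x * u ≤ (1 - u) ^ x * (1 + r * u) ^ y := by
        rw [← sub_eq_add_neg] at hb; linarith
      have hpos : 0 < u ^ (e - 1) := Real.rpow_pos_of_pos h0 _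
      have h5 := mul_le_mul_of_nonneg_right h4 hpos.le
      have h6 : u * u ^ (e - 1) ≤ 1 := by
        rw [hp, mul_div_cancel₀ _ h0.ne']
        exact Real.rpow_le_one h0.le h1.le he.le
      have h7 : (x:ℝ) * (u * u ^ (e - 1)) ≤ x * 1 := by gcongr
      rw [Real.rpow_zero]
      linarith
    rw [integral_sub hI1 hI2, hv, hv2] at this
    have := mul_le_mul_of_nonneg_left this he.le
    rw [mul_sub, mul_one_div_cancel he.ne'] at this
    exact this
  · have : ∫ u in Set.Ioo (0:ℝ) 1, (1 - u) ^ x * (1 + r * u) ^ y * u ^ (e - 1) ≤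
        ∫ u in Set.Ioo (0:ℝ) 1, (1:ℝ) * u ^ (e - 1) := by
      refine setIntegral_mono_on hI hI1 measurableSet_Ioo fun u hu => ?_
      have := aux_f_le r u hr hu x y
      have h2 : Real.exp (-((x - r * y) * u)) ≤ 1 := by
        rw [Real.exp_le_one_iff]
        have := mul_nonneg (sub_nonneg.2 hxy) hu.1.le
        linarith
      have hpos : 0 < u ^ (e - 1) := Real.rpow_pos_of_pos hu.1 _
      gcongr
      linarith
    rw [hv] at this
    have := mul_le_mul_of_nonneg_left this he.le
    rwa [mul_one_div_cancel he.ne'] at this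

lemma aux_b (r e w : ℝ) (hr : 0 < r) (he : 0 < e) (hw : 0 < w) (x y : ℕ) (hxy : w ≤ x - r * y) :
    ∫ u in Set.Ioo (0:ℝ) 1, (1 - u) ^ x * (1 + r * u) ^ y * u ^ e ≤ 1 / w := by
  have hI := aux_int (fun u => (1 - u) ^ x * (1 + r * u) ^ y) (by fun_prop) e (by linarith)
  have hE : IntegrableOn (fun u : ℝ => Real.exp (-w * u)) (Set.Ioi 0) :=
    integrableOn_exp_mul_Ioi (by linarith) 0
  calc _ ≤ ∫ u in Set.Ioo (0:ℝ) 1, Real.exp (-w * u) := by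
        refine setIntegral_mono_on hI (hE.mono_set Set.Ioo_subset_Ioi_self) measurableSet_Ioo
          fun u hu => ?_
        have h1 := aux_f_le r u hr hu x y
        have h2 : Real.exp (-((x - r * y) * u)) ≤ Real.exp (-w * u) := by
          rw [Real.exp_le_exp]
          have := mul_le_mul_of_nonneg_right hxy hu.1.le
          linarith
        have h3 : u ^ e ≤ 1 := Real.rpow_le_one hu.1.le hu.2.le he.le
        have h4 : 0 ≤ u ^ e := Real.rpow_nonneg hu.1.le _
        have h5 := Real.exp_pos (-w * u)
        calc _ ≤ Real.exp (-w * u) * 1 := by gcongr; exact h1.trans h2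
          _ = _ := mul_one _
    _ ≤ ∫ u in Set.Ioi (0:ℝ), Real.exp (-w * u) :=
        setIntegral_mono_set hE (Eventually.of_forall fun u => (Real.exp_pos _).le)
          (Set.Ioo_subset_Ioi_self.eventuallyLE)
    _ = 1 / w := by
        rw [integral_exp_mul_Ioi (by linarith)]; simp

lemma aux_D (a e : ℝ) (ha : 0 < a) (he : 0 < e) (p q N : ℕ) (hq : q ≤ N) :
    e * ∫ u in Set.Ioo (0:ℝ) 1, (1 - u) ^ (p + 1) * (1 + a * u) ^ q * u ^ (e - 1) ≤
      Real.exp a + e * N * ∫ u in Set.Ioo (0:ℝ) 1, (1 - u) ^ p * (1 + a * u) ^ q * u ^ e := by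
  have hI := aux_int (fun u => (1 - u) ^ (p+1) * (1 + a * u) ^ q) (by fun_prop) (e - 1)
    (by linarith)
  have hI1 := aux_int (fun u => Real.exp a) (by fun_prop) (e - 1) (by linarith)
  have hI2 := (aux_int (fun u => (1 - u) ^ p * (1 + a * u) ^ q) (by fun_prop) e
    (by linarith)).const_mul (N:ℝ)
  have hv : ∫ u in Set.Ioo (0:ℝ) 1, Real.exp a * u ^ (e - 1) = Real.exp a * (1 / e) := by
    rw [integral_const_mul, aux_pow _ (by linarith)]; simp
  have : ∫ u in Set.Ioo (0:ℝ) 1, (1 - u) ^ (p + 1) * (1 + a * u) ^ q * u ^ (e - 1) ≤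
      ∫ u in Set.Ioo (0:ℝ) 1, (Real.exp a * u ^ (e - 1) +
        N * ((1 - u) ^ p * (1 + a * u) ^ q * u ^ e)) := by
    refine setIntegral_mono_on hI (hI1.add hI2) measurableSet_Ioo fun u hu => ?_
    have h0 := hu.1
    have h1 := hu.2
    have hp : u ^ e = u * u ^ (e - 1) := by
      rw [Real.rpow_sub h0, Real.rpow_one, mul_div_cancel₀ _ h0.ne']
    have hpos : 0 < u ^ (e - 1) := Real.rpow_pos_of_pos h0 _
    have hau : 0 < a * u := mul_pos ha h0
    have h1u : 0 ≤ 1 - u := by linarith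
    have hX : 0 ≤ (1 - u) ^ p * (1 + a * u) ^ q := by positivity
    rcases le_total ((N:ℝ) * u) 1 with h | h
    · have h2 : (1 + a * u) ^ q ≤ Real.exp a := by
        calc (1 + a * u) ^ q ≤ (Real.exp (a * u)) ^ q := by
              have : 1 + a * u ≤ Real.exp (a * u) := by linarith [Real.add_one_le_exp (a * u)]
              gcongr
          _ = Real.exp (q * (a * u)) := by rw [← Real.exp_nat_mul]
          _ ≤ Real.exp a := by
              rw [Real.exp_le_exp]
              have : (q:ℝ) ≤ N := by exact_mod_cast hq
              have : (q:ℝ) * u ≤ 1 := (mul_le_mul_of_nonneg_right this h0.le).trans h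
              nlinarith
      have h3 : (1 - u) ^ (p + 1) ≤ 1 := pow_le_one₀ h1u (by linarith)
      have h4 : (1 - u) ^ (p + 1) * (1 + a * u) ^ q * u ^ (e - 1) ≤
          1 * Real.exp a * u ^ (e - 1) := by gcongr
      have h5 : 0 ≤ N * ((1 - u) ^ p * (1 + a * u) ^ q * u ^ e) := by
        rw [hp]; positivity
      linarith
    · have h5 : 0 ≤ Real.exp a * u ^ (e - 1) := by positivity
      have h6 : (1 - u) ^ (p + 1) * (1 + a * u) ^ q * u ^ (e - 1) ≤
          N * ((1 - u) ^ p * (1 + a * u) ^ q * u ^ e) := by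
        have e1 : (1 - u) ^ (p + 1) * (1 + a * u) ^ q * u ^ (e - 1) =
          ((1 - u) ^ p * (1 + a * u) ^ q * u ^ (e - 1)) * (1 - u) := by ring
        have e2 : N * ((1 - u) ^ p * (1 + a * u) ^ q * u ^ e) =
          ((1 - u) ^ p * (1 + a * u) ^ q * u ^ (e - 1)) * (N * u) := by rw [hp]; ring
        rw [e1, e2]
        exact mul_le_mul_of_nonneg_left (by linarith) (by positivity)
      linarith
  rw [integral_add hI1 hI2, hv, integral_const_mul] at this
  have := mul_le_mul_of_nonneg_left this he.le
  refine this.trans (le_of_eq ?_)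
  rw [mul_add, mul_left_comm, mul_one_div_cancel he.ne', mul_one, mul_assoc]

lemma aux_d (a e c : ℝ) (ha : 0 < a) (he : 0 < e) (he1 : e ≤ 1) (hc : 0 < c) (p q N : ℕ)
    (hN : p + q ≤ N) (h : c * N ≤ q * a - p) :
    (min (c / a) 1) ^ 2 / 2 ≤ ∫ u in Set.Ioo (0:ℝ) 1, (1 - u) ^ p * (1 + a * u) ^ q * u ^ e := by
  have hI := aux_int (fun u => (1 - u) ^ p * (1 + a * u) ^ q) (by fun_prop) e (by linarith)
  set δ := min (c / a) 1 with hδ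
  have hδ0 : 0 < δ := lt_min (by positivity) one_pos
  have hδ1 : δ ≤ 1 := min_le_right _ _
  have hsub : Set.Ioo (0:ℝ) δ ⊆ Set.Ioo 0 1 := Set.Ioo_subset_Ioo_right hδ1
  calc δ ^ 2 / 2 = ∫ u in Set.Ioo (0:ℝ) δ, u := by
        rw [← integral_Ioc_eq_integral_Ioo, ← intervalIntegral.integral_of_le hδ0.le, integral_id]
        ring
    _ ≤ ∫ u in Set.Ioo (0:ℝ) δ, (1 - u) ^ p * (1 + a * u) ^ q * u ^ e := by
        refine setIntegral_mono_on ?_ (hI.mono_set hsub) measurableSet_Ioo fun u hu => ?_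
        · exact (continuous_id.integrableOn_Icc (a := 0) (b := δ)).mono_set Set.Ioo_subset_Icc_self
        have h0 := hu.1
        have h1 := (hsub hu).2
        have hau : 0 < a * u := mul_pos ha h0
        have h1u : 0 < 1 - u := by linarith
        have hua : u * a ≤ c := by
          have : u ≤ c / a := hu.2.le.trans (min_le_left _ _)
          rwa [le_div_iff₀ ha] at this
        have g1 : Real.exp (-(u / (1 - u))) ≤ 1 - u := by
          rw [Real.exp_neg, inv_le_comm₀ (Real.exp_pos _) h1u]
          have := Real.add_one_le_exp (u / (1 - u))
          refine le_trans (le_of_eq ?_) this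
          field_simp; ring
        have g2 : Real.exp (a * u / (1 + a * u)) ≤ 1 + a * u := by
          have := Real.add_one_le_exp (-(a * u / (1 + a * u)))
          rw [Real.exp_neg] at this
          rw [← inv_le_inv₀ (by positivity) (Real.exp_pos _)]
          refine le_trans (le_of_eq ?_) this
          field_simp; ring
        have key : 1 ≤ (1 - u) ^ p * (1 + a * u) ^ q := by
          calc (1:ℝ) ≤ Real.exp (p * (-(u / (1 - u))) + q * (a * u / (1 + a * u))) := by
                rw [Real.one_le_exp_iff]
                have : p * (-(u / (1 - u))) + q * (a * u / (1 + a * u)) =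
                  u * (q * a - p - u * a * (p + q)) / ((1 - u) * (1 + a * u)) := by
                  field_simp; ring
                rw [this]
                have hN' : (p:ℝ) + q ≤ N := by exact_mod_cast hN
                have : u * a * (p + q) ≤ c * N := by gcongr
                have : 0 ≤ q * a - p - u * a * (p + q) := by linarith
                positivity
            _ = Real.exp (-(u / (1 - u))) ^ p * Real.exp (a * u / (1 + a * u)) ^ q := by
                rw [Real.exp_add, Real.exp_nat_mul, Real.exp_nat_mul]
            _ ≤ _ := by gcongr
        have h3 : u ≤ u ^ e := by
          have := Real.rpow_le_rpow_of_exponent_ge h0 h1.le he1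
          rwa [Real.rpow_one] at this
        have h4 : 0 ≤ u ^ e := Real.rpow_nonneg h0.le _
        nlinarith [mul_le_mul_of_nonneg_right key h4]
    _ ≤ _ := by
        refine setIntegral_mono_set hI ?_ hsub.eventuallyLE
        filter_upwards [ae_restrict_mem measurableSet_Ioo] with u hu
        have h0 := hu.1
        have h1u : 0 ≤ 1 - u := by linarith [hu.2]
        have h4 : 0 ≤ u ^ e := Real.rpow_nonneg h0.le _
        have hau : 0 < a * u := mul_pos ha h0
        simp only [Pi.zero_apply]
        positivity

lemma aux_hint (ν : ℝ) (hν : 0 < ν) (N : ℕ) :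
    ∫ u in Set.Ioo (0:ℝ) 1, (1 - ν + ν * u) ^ N = (1 - (1 - ν) ^ (N + 1)) / (ν * (N + 1)) := by
  rw [← integral_Ioc_eq_integral_Ioo, ← intervalIntegral.integral_of_le zero_le_one]
  have : ∀ u ∈ Set.uIcc (0:ℝ) 1, HasDerivAt
      (fun u : ℝ => (1 - ν + ν * u) ^ (N + 1) / (ν * (N + 1))) ((1 - ν + ν * u) ^ N) u := by
    intro u _
    have h1 : HasDerivAt (fun u : ℝ => 1 - ν + ν * u) ν u := by
      simpa using ((hasDerivAt_id u).const_mul ν).const_add (1 - ν)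
    have h2 := (h1.pow (N + 1)).div_const (ν * (N + 1))
    have h3 : (N:ℝ) + 1 ≠ 0 := by positivity
    refine h2.congr_deriv ?_
    rw [Nat.add_sub_cancel]
    push_cast
    field_simp
  rw [intervalIntegral.integral_eq_sub_of_hasDerivAt this
    ((by fun_prop : Continuous fun u : ℝ => (1 - ν + ν * u) ^ N).intervalIntegrable _ _)]
  simp only [mul_one, mul_zero, add_zero, sub_add_cancel, one_pow]
  rw [sub_div]

/-- The tail part of `B_0`. -/
lemma aux_G (ν : ℝ) (hν : 0 < ν) (hν1 : ν < 1) (e : ℕ → ℝ) (he : ∀ᶠ N in atTop, 0 < e N ∧ e N ≤ 1) :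
    Tendsto (fun N : ℕ => (N:ℝ) * ∫ u in Set.Ioo (0:ℝ) 1,
      ((1 - ν + ν * u) ^ N - (1 - ν) ^ N) * u ^ (e N - 1)) atTop (𝓝 (1 / ν)) := by
  have hm0 : 0 < 1 - ν := by linarith
  have hm1 : 1 - ν < 1 := by linarith
  have hfrac : Tendsto (fun N : ℕ => (N:ℝ) / (N + 1)) atTop (𝓝 1) :=
    tendsto_natCast_div_add_atTop 1
  have hpw : Tendsto (fun N : ℕ => (1 - ν) ^ (N + 1)) atTop (𝓝 0) :=
    (tendsto_pow_atTop_nhds_zero_of_lt_one hm0.le hm1).comp (tendsto_add_atTop_nat 1)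
  have hnp : Tendsto (fun N : ℕ => (N:ℝ) * (1 - ν) ^ N) atTop (𝓝 0) :=
    tendsto_self_mul_const_pow_of_lt_one hm0.le hm1
  have hmain : Tendsto (fun N : ℕ => (N:ℝ) / (N + 1) * (1 - (1 - ν) ^ (N + 1)) / ν) atTop
      (𝓝 (1 / ν)) := by
    simpa using (hfrac.mul (hpw.const_sub 1)).div_const ν
  have hIc : ∀ N : ℕ, IntegrableOn (fun u : ℝ => (1 - ν + ν * u) ^ N) (Set.Ioo 0 1) := fun N =>
    ((by fun_prop : Continuous fun u : ℝ => (1 - ν + ν * u) ^ N).integrableOn_Icc).mono_set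
      Set.Ioo_subset_Icc_self
  have hcc : ∀ k : ℝ, IntegrableOn (fun _ : ℝ => k) (Set.Ioo 0 1) := fun k =>
    (continuous_const.integrableOn_Icc).mono_set Set.Ioo_subset_Icc_self
  have hcv : ∀ k : ℝ, ∫ _ in Set.Ioo (0:ℝ) 1, k = k := fun k => by simp
  rw [tendsto_order]
  constructor
  · intro A hA
    have hl : Tendsto (fun N : ℕ => (N:ℝ) / (N + 1) * (1 - (1 - ν) ^ (N + 1)) / ν -
        N * (1 - ν) ^ N) atTop (𝓝 (1 / ν)) := by simpa using hmain.sub hnp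
    filter_upwards [he, hl.eventually_const_lt hA] with N hN hlN
    refine hlN.trans_le ?_
    have : ∫ u in Set.Ioo (0:ℝ) 1, ((1 - ν + ν * u) ^ N - (1 - ν) ^ N) ≤ ∫ u in Set.Ioo (0:ℝ) 1,
      ((1 - ν + ν * u) ^ N - (1 - ν) ^ N) * u ^ (e N - 1) := by
      refine setIntegral_mono_on ((hIc N).sub (hcc _))
        (aux_int (fun u => (1 - ν + ν * u) ^ N - (1 - ν) ^ N) (by fun_prop) _ (by linarith [hN.1]))
        measurableSet_Ioo fun u hu => ?_
      have h0 : 0 < ν * u := mul_pos hν hu.1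
      have h1 : (1 - ν) ^ N ≤ (1 - ν + ν * u) ^ N := by gcongr; linarith
      exact le_mul_of_one_le_right (by linarith)
        (Real.one_le_rpow_of_pos_of_le_one_of_nonpos hu.1 hu.2.le (by linarith [hN.2]))
    rw [integral_sub (hIc N) (hcc _), hcv, aux_hint ν hν] at this
    have := mul_le_mul_of_nonneg_left this (Nat.cast_nonneg (α := ℝ) N)
    refine le_trans (le_of_eq ?_) this
    have : (N:ℝ) + 1 ≠ 0 := by positivity
    field_simp
  · intro A hA
    obtain ⟨δ, hδ0, hδ1, hδA⟩ : ∃ δ : ℝ, 0 < δ ∧ δ < 1 ∧ 1 / ν / δ < A := by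
      have hA0 : 0 < A := lt_trans (by positivity) hA
      obtain ⟨δ, h1, h2⟩ := exists_between (show 1 / ν / A < 1 by rwa [div_lt_one hA0])
      have hδ0 : 0 < δ := lt_trans (by positivity) h1
      refine ⟨δ, hδ0, h2, ?_⟩
      rw [div_lt_iff₀ hA0] at h1
      rw [div_lt_iff₀ hδ0]; linarith
    set h := 1 - ν + ν * δ with hh
    have hh0 : 0 < h := by positivity
    have hh1 : h < 1 := by nlinarith
    have hl2 : Tendsto (fun N : ℕ => (N:ℝ) ^ 2 * h ^ N) atTop (𝓝 0) :=
      tendsto_pow_const_mul_const_pow_of_lt_one 2 hh0.le hh1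
    have hl : Tendsto (fun N : ℕ => (N:ℝ) / (N + 1) * (1 - (1 - ν) ^ (N + 1)) / ν / δ +
        (ν / h) * (N ^ 2 * h ^ N)) atTop (𝓝 (1 / ν / δ)) := by
      simpa using (hmain.div_const δ).add (hl2.const_mul (ν / h))
    filter_upwards [he, hl.eventually_lt_const hδA] with N hN hlN
    refine lt_of_le_of_lt ?_ hlN
    have : ∫ u in Set.Ioo (0:ℝ) 1, ((1 - ν + ν * u) ^ N - (1 - ν) ^ N) * u ^ (e N - 1) ≤
        ∫ u in Set.Ioo (0:ℝ) 1, ((1 - ν + ν * u) ^ N / δ + ν / h * (N * h ^ N)) := by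
      refine setIntegral_mono_on
        (aux_int (fun u => (1 - ν + ν * u) ^ N - (1 - ν) ^ N) (by fun_prop) _ (by linarith [hN.1]))
        (((hIc N).div_const δ).add (hcc _)) measurableSet_Ioo fun u hu => ?_
      have h0 : 0 < ν * u := mul_pos hν hu.1
      have h1 : (1 - ν) ^ N ≤ (1 - ν + ν * u) ^ N := by gcongr; linarith
      have h2 : u ^ (e N - 1) ≤ 1 / u := by
        rw [Real.rpow_sub hu.1, Real.rpow_one]
        have := hu.1
        gcongr
        exact Real.rpow_le_one hu.1.le hu.2.le hN.1.le
      have hu0 := hu.1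
      have hp : 0 < (1 - ν) ^ N := by positivity
      refine (mul_le_mul_of_nonneg_left h2 (by linarith)).trans ?_
      rw [mul_one_div]
      rcases le_total δ u with hδu | hδu
      · have : ((1 - ν + ν * u) ^ N - (1 - ν) ^ N) / u ≤ (1 - ν + ν * u) ^ N / δ := by
          gcongr
          linarith
        have : 0 ≤ ν / h * (N * h ^ N) := by positivity
        linarith
      · have hle : 1 - ν + ν * u ≤ h := by rw [hh]; gcongr
        have : (1 - ν + ν * u) ^ N - (1 - ν) ^ N ≤ N * (ν * u) * h ^ (N - 1) := by
          rw [← geom_sum₂_mul]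
          have : ∑ i ∈ Finset.range N, (1 - ν + ν * u) ^ i * (1 - ν) ^ (N - 1 - i) ≤
              ∑ i ∈ Finset.range N, h ^ (N - 1) := by
            refine Finset.sum_le_sum fun i hi => ?_
            have hi' := Finset.mem_range.1 hi
            calc _ ≤ h ^ i * h ^ (N - 1 - i) := by
                  have : 1 - ν ≤ h := by linarith
                  gcongr
              _ = _ := by rw [← pow_add]; congr 1; omega
          rw [Finset.sum_const, Finset.card_range, nsmul_eq_mul] at this
          have := mul_le_mul_of_nonneg_right this h0.le
          linarith
        have h3 : ((1 - ν + ν * u) ^ N - (1 - ν) ^ N) / u ≤ ν / h * (N * h ^ N) := by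
          rw [div_le_iff₀ hu0]
          refine this.trans (le_of_eq ?_)
          rcases N with _ | n
          · simp
          · simp only [Nat.add_sub_cancel, pow_succ]
            field_simp
        have : 0 ≤ (1 - ν + ν * u) ^ N / δ := by positivity
        linarith
    rw [integral_add ((hIc N).div_const δ) (hcc _), hcv, integral_div, aux_hint ν hν] at this
    have := mul_le_mul_of_nonneg_left this (Nat.cast_nonneg (α := ℝ) N)
    refine this.trans (le_of_eq ?_)
    have : (N:ℝ) + 1 ≠ 0 := by positivity
    field_simp

/-- Sub-critical regime (Proposition 9): convergence of the Laplace transform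
`E_{C_N}(e^{-α_N T_0})` to `ν/(ν+α)` with `α_N = α N (1-ν)^N`. -/
theorem subcritical_empty_state_laplace_limit
    (ν η μ α : ℝ) (hν : 0 < ν) (hνη : ν < η) (hη : η < 1) (hμ : μ = 1 - ν)
    (hα : 0 < α) (C : ℕ → ℕ)
    (hC1 : ∀ᶠ N in atTop, 1 ≤ C N ∧ C N + 1 ≤ N)
    (hC : (fun N : ℕ => (C N : ℝ) - η * N) =O[atTop] fun _ : ℕ => (1 : ℝ))
    (αN : ℕ → ℝ) (hαN : ∀ N : ℕ, αN N = α * N * (1 - ν) ^ N)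
    (B D : ℕ → ℕ → ℝ)
    (hB : ∀ N x, B N x = ∫ u in Set.Ioo (0:ℝ) 1,
        (1 - u) ^ x * (1 + (ν / μ) * u) ^ (N - x) * u ^ (αN N - 1))
    (hD : ∀ N x, D N x = ∫ u in Set.Ioo (0:ℝ) 1,
        (1 - u) ^ (N - x) * (1 + (μ / ν) * u) ^ x * u ^ (αN N - 1))
    (b d : ℕ → ℝ)
    (hb : ∀ N, b N = ν * ∫ u in Set.Ioo (0:ℝ) 1,
        (1 - u) ^ (C N) * (1 + (ν / μ) * u) ^ (N - C N - 1) * u ^ (αN N))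
    (hd : ∀ N, d N = μ * ∫ u in Set.Ioo (0:ℝ) 1,
        (1 - u) ^ (N - C N - 1) * (1 + (μ / ν) * u) ^ (C N) * u ^ (αN N)) :
    Tendsto (fun N : ℕ =>
        (d N * B N (C N) + b N * D N (C N)) / (d N * B N 0 + b N * D N 0))
      atTop (𝓝 (ν / (ν + α))) := by
  have hν1 : ν < 1 := hνη.trans hη
  have hm0 : 0 < μ := by linarith
  have hm1 : μ < 1 := by linarith
  have hr : 0 < ν / μ := by positivity
  have ha : 0 < μ / ν := by positivity
  rw [← hμ] at hαN
  have hε0 : Tendsto αN atTop (𝓝 0) := by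
    have := (tendsto_self_mul_const_pow_of_lt_one hm0.le hm1).const_mul α
    rw [mul_zero] at this
    refine this.congr fun N => ?_
    rw [hαN]; ring
  have hεN : Tendsto (fun N : ℕ => αN N * N) atTop (𝓝 0) := by
    have := (tendsto_pow_const_mul_const_pow_of_lt_one 2 hm0.le hm1).const_mul α
    rw [mul_zero] at this
    refine this.congr fun N => ?_
    rw [hαN]; ring
  have hεpos : ∀ᶠ N in atTop, 0 < αN N ∧ αN N ≤ 1 := by
    filter_upwards [hε0.eventually_le_const (zero_lt_one), eventually_gt_atTop 0] with N h1 h2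
    refine ⟨?_, h1⟩
    rw [hαN]; positivity
  set c := (η - ν) / 2 with hc
  have hc0 : 0 < c := by rw [hc]; linarith
  have hw : ∀ᶠ N : ℕ in atTop, c * N ≤ (C N : ℝ) - ν * N := by
    obtain ⟨K, hK⟩ := hC.bound
    have : ∀ᶠ N : ℕ in atTop, K ≤ c * N :=
      (tendsto_natCast_atTop_atTop.const_mul_atTop hc0).eventually_ge_atTop K
    filter_upwards [hK, this] with N h1 h2
    simp only [norm_one, mul_one, Real.norm_eq_abs] at h1
    have := (abs_le.1 h1).1
    have : c * N = (η * N - ν * N) / 2 := by rw [hc]; ring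
    linarith
  -- basic facts, bundled
  have hfacts : ∀ᶠ N : ℕ in atTop, c * N ≤ (C N : ℝ) - ν / μ * ((N - C N : ℕ) : ℝ) ∧
      c * N ≤ (C N : ℝ) - ν / μ * ((N - C N - 1 : ℕ) : ℝ) ∧
      c * N ≤ (C N : ℝ) * (μ / ν) - ((N - C N - 1 : ℕ) : ℝ) := by
    filter_upwards [hw, hC1, eventually_gt_atTop 0] with N h1 h2 h3
    have e1 : ((N - C N : ℕ) : ℝ) = N - C N := by
      rw [Nat.cast_sub (by omega)]
    have e2 : ((N - C N - 1 : ℕ) : ℝ) = N - C N - 1 := by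
      rw [Nat.cast_sub (by omega), e1]; simp
    have hcN : 0 ≤ c * N := by positivity
    have h0 : 0 ≤ (C N : ℝ) - ν * N := hcN.trans h1
    have f1 : c * N ≤ (C N : ℝ) - ν / μ * (N - C N) := by
      have : (C N : ℝ) - ν / μ * (N - C N) = (C N - ν * N) / μ := by
        field_simp; rw [hμ]; ring
      rw [this, le_div_iff₀ hm0]
      nlinarith
    refine ⟨by rw [e1]; exact f1, ?_, ?_⟩
    · rw [e2]; nlinarith
    · rw [e2]
      have : (C N : ℝ) * (μ / ν) - (N - C N - 1) = (C N - ν * N) / ν + 1 := by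
        field_simp; rw [hμ]; ring
      rw [this]
      have : c * N ≤ (C N - ν * N) / ν := by
        rw [le_div_iff₀ hν]
        nlinarith
      linarith
  have hBC : Tendsto (fun N => αN N * B N (C N)) atTop (𝓝 1) := by
    have hlow : Tendsto (fun N : ℕ => 1 - αN N * N) atTop (𝓝 1) := by
      simpa using hεN.const_sub 1
    refine tendsto_of_tendsto_of_tendsto_of_le_of_le' hlow tendsto_const_nhds ?_ ?_
    · filter_upwards [hεpos, hfacts, hC1] with N h1 h2 h3
      have := (aux_BC (ν / μ) (αN N) hr h1.1 (C N) (N - C N) (by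
        have : 0 ≤ c * N := by positivity
        linarith [h2.1])).1
      rw [hB]
      refine le_trans ?_ this
      have : (C N : ℝ) ≤ N := by exact_mod_cast (by omega)
      have := mul_le_mul_of_nonneg_left this h1.1.le
      linarith
    · filter_upwards [hεpos, hfacts] with N h1 h2
      rw [hB]
      exact (aux_BC (ν / μ) (αN N) hr h1.1 (C N) (N - C N) (by
        have : 0 ≤ c * N := by positivity
        linarith [h2.1])).2
  have hB0 : Tendsto (fun N => αN N * B N 0) atTop (𝓝 (1 + α * (1 / ν))) := by
    have hG := ((aux_G ν hν hν1 αN hεpos).const_mul α).const_add 1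
    refine hG.congr' ?_
    filter_upwards [hεpos] with N hN
    have hI1 := aux_int (fun u => (1 - ν + ν * u) ^ N - (1 - ν) ^ N) (by fun_prop) (αN N - 1)
      (by linarith [hN.1])
    have hI2 := aux_int (fun u => (1 - ν) ^ N) (by fun_prop) (αN N - 1) (by linarith [hN.1])
    have e1 : B N 0 = (μ ^ N)⁻¹ * ∫ u in Set.Ioo (0:ℝ) 1,
        (((1 - ν + ν * u) ^ N - (1 - ν) ^ N) * u ^ (αN N - 1) +
          (1 - ν) ^ N * u ^ (αN N - 1)) := by
      rw [hB, ← integral_const_mul]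
      congr 1
      funext u
      have : 1 + ν / μ * u = (1 - ν + ν * u) / μ := by rw [← hμ]; field_simp
      rw [this, div_pow]
      simp only [pow_zero, Nat.sub_zero]
      ring
    rw [e1, integral_add hI1 hI2, integral_const_mul, aux_pow _ (by linarith [hN.1]), ← hμ]
    have hN0 := hN.1.ne'
    have hmN : μ ^ N ≠ 0 := by positivity
    set J := ∫ u in Set.Ioo (0:ℝ) 1, ((μ + ν * u) ^ N - μ ^ N) * u ^ (αN N - 1)
    have e2 : αN N * ((μ ^ N)⁻¹ * (J + μ ^ N * (1 / (αN N - 1 + 1)))) =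
        αN N * (μ ^ N)⁻¹ * J + 1 := by
      rw [sub_add_cancel]; field_simp
    rw [e2, hαN]
    field_simp
    ring
  -- lower bound for d
  set κ := μ * ((min (c / (μ / ν)) 1) ^ 2 / 2) with hκ
  have hκ0 : 0 < κ := by
    have : 0 < min (c / (μ / ν)) 1 := lt_min (by positivity) one_pos
    positivity
  have hdl : ∀ᶠ N in atTop, κ ≤ d N := by
    filter_upwards [hεpos, hfacts, hC1] with N h1 h2 h3
    rw [hd, hκ]
    exact mul_le_mul_of_nonneg_left (aux_d (μ / ν) (αN N) c ha h1.1 h1.2 hc0 (N - C N - 1) (C N) N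
      (by omega) h2.2.2) hm0.le
  have hnn : ∀ (a e : ℝ) (p q : ℕ), 0 < a →
      0 ≤ ∫ u in Set.Ioo (0:ℝ) 1, (1 - u) ^ p * (1 + a * u) ^ q * u ^ e := by
    intro a e p q ha
    refine setIntegral_nonneg measurableSet_Ioo fun u hu => ?_
    have h0 := hu.1
    have h1 : 0 ≤ 1 - u := by linarith [hu.2]
    have h4 : 0 ≤ u ^ e := Real.rpow_nonneg h0.le _
    positivity
  have hb0 : ∀ N, 0 ≤ b N := fun N => by
    rw [hb]; exact mul_nonneg hν.le (hnn _ _ _ _ hr)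
  have hD0 : ∀ N x, 0 ≤ D N x := fun N x => by
    rw [hD]; exact hnn _ _ _ _ ha
  have hbl : Tendsto b atTop (𝓝 0) := by
    have : Tendsto (fun N : ℕ => ν / c * (1 / (N:ℝ))) atTop (𝓝 0) := by
      simpa using tendsto_one_div_atTop_nhds_zero_nat.const_mul (ν / c)
    refine tendsto_of_tendsto_of_tendsto_of_le_of_le' tendsto_const_nhds this
      (Eventually.of_forall hb0) ?_
    filter_upwards [hεpos, hfacts, eventually_gt_atTop 0] with N h1 h2 h3
    have h3' : (0:ℝ) < N := by exact_mod_cast h3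
    have := aux_b (ν / μ) (αN N) (c * N) hr h1.1 (by positivity) (C N) (N - C N - 1) h2.2.1
    rw [hb]
    refine (mul_le_mul_of_nonneg_left this hν.le).trans (le_of_eq ?_)
    field_simp
  have hDC : Tendsto (fun N => αN N * (b N * D N (C N)) / d N) atTop (𝓝 0) := by
    have hlim : Tendsto (fun N : ℕ => b N * (Real.exp (μ / ν) / κ + αN N * N / μ)) atTop (𝓝 0) := by
      simpa using hbl.mul ((hεN.div_const μ).const_add (Real.exp (μ / ν) / κ))
    refine tendsto_of_tendsto_of_tendsto_of_le_of_le' tendsto_const_nhds hlim ?_ ?_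
    · filter_upwards [hεpos, hdl] with N h1 h2
      have := h1.1
      have := hb0 N
      have := hD0 N (C N)
      have : 0 < d N := hκ0.trans_le h2
      positivity
    · filter_upwards [hεpos, hdl, hC1] with N h1 h2 h3
      have hdp : 0 < d N := hκ0.trans_le h2
      have key := aux_D (μ / ν) (αN N) ha h1.1 (N - C N - 1) (C N) N (by omega)
      rw [show N - C N - 1 + 1 = N - C N by omega, ← hD] at key
      have hdd : ∫ u in Set.Ioo (0:ℝ) 1,
        (1 - u) ^ (N - C N - 1) * (1 + (μ / ν) * u) ^ (C N) * u ^ (αN N) = d N / μ := by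
        rw [hd, mul_div_cancel_left₀ _ hm0.ne']
      rw [hdd] at key
      have : αN N * D N (C N) / d N ≤ Real.exp (μ / ν) / κ + αN N * N / μ := by
        calc _ ≤ (Real.exp (μ / ν) + αN N * N * (d N / μ)) / d N := by gcongr
          _ = Real.exp (μ / ν) / d N + αN N * N / μ := by field_simp
          _ ≤ _ := by gcongr
      have := mul_le_mul_of_nonneg_left this (hb0 N)
      refine le_trans (le_of_eq ?_) this
      ring
  have hDz : Tendsto (fun N => αN N * (b N * D N 0) / d N) atTop (𝓝 0) := by
    have hlim : Tendsto (fun N : ℕ => b N * (1 / κ)) atTop (𝓝 0) := by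
      simpa using hbl.mul_const (1 / κ)
    refine tendsto_of_tendsto_of_tendsto_of_le_of_le' tendsto_const_nhds hlim ?_ ?_
    · filter_upwards [hεpos, hdl] with N h1 h2
      have := h1.1
      have := hb0 N
      have := hD0 N 0
      have : 0 < d N := hκ0.trans_le h2
      positivity
    · filter_upwards [hεpos, hdl] with N h1 h2
      have hdp : 0 < d N := hκ0.trans_le h2
      have key := (aux_BC (μ / ν) (αN N) ha h1.1 (N - 0) 0 (by simp)).2
      rw [← hD] at key
      have : αN N * D N 0 / d N ≤ 1 / κ := by gcongr
      have := mul_le_mul_of_nonneg_left this (hb0 N)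
      refine le_trans (le_of_eq ?_) this
      ring
  have hfin := (hBC.add hDC).div (hB0.add hDz) (by positivity)
  have hval : (1 + 0) / (1 + α * (1 / ν) + 0) = ν / (ν + α) := by field_simp; simp
  rw [hval] at hfin
  refine hfin.congr' ?_
  filter_upwards [hεpos, hdl] with N h1 h2
  have hdp : 0 < d N := hκ0.trans_le h2
  have hap := h1.1
  have e1 : ∀ x, αN N * B N x + αN N * (b N * D N x) / d N =
      (αN N / d N) * (d N * B N x + b N * D N x) := by
    intro x; field_simp
  simp only [Pi.div_apply, e1]
  rw [mul_div_mul_left _ _ (by positivity)]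
end

section
/- Let ν ∈ (0,1), μ = 1 − ν, α > 0, and let (C_N) be a sequence of integers with 1 ≤ C_N ≤ N−1 and C_N = νN + o(√N). Set α_N = α·N·(1−ν)^N and define B_x = ∫₀¹ (1−u)^x (1+(ν/μ)u)^{N−x} u^{α_N−1} du, D_x = ∫₀¹ (1−u)^{N−x} (1+(μ/ν)u)^x u^{α_N−1} du, b_N = ν ∫₀¹ (1−u)^{C_N} (1+(ν/μ)u)^{N−C_N−1} u^{α_N} du, d_N = μ ∫₀¹ (1−u)^{N−C_N−1} (1+(μ/ν)u)^{C_N} u^{α_N} du. Then lim_{N→∞} (d_N·B_{C_N} + b_N·D_{C_N}) / (d_N·B_0 + b_N·D_0) = 2ν/(2ν+α). -/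
open Filter Topology MeasureTheory Asymptotics

lemma aux_scale (f : ℝ → ℝ) {M : ℝ} (hM : 0 < M) :
    M * ∫ u in Set.Ioo (0:ℝ) 1, f u =
      ∫ t in Set.Ioi (0:ℝ), Set.indicator (Set.Ioo 0 M) (fun t => f (t / M)) t := by
  rw [setIntegral_indicator measurableSet_Ioo]
  have : Set.Ioi (0:ℝ) ∩ Set.Ioo 0 M = Set.Ioo 0 M := by
    ext x; simp
  rw [this, ← integral_Ioc_eq_integral_Ioo, ← integral_Ioc_eq_integral_Ioo,
    ← intervalIntegral.integral_of_le hM.le, ← intervalIntegral.integral_of_le zero_le_one,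
    intervalIntegral.integral_comp_div f hM.ne']
  simp [hM.ne']

lemma aux_reflect (f : ℝ → ℝ) :
    ∫ u in Set.Ioo (0:ℝ) 1, f u = ∫ u in Set.Ioo (0:ℝ) 1, f (1 - u) := by
  rw [← integral_Ioc_eq_integral_Ioo, ← integral_Ioc_eq_integral_Ioo,
    ← intervalIntegral.integral_of_le zero_le_one, ← intervalIntegral.integral_of_le zero_le_one,
    intervalIntegral.integral_comp_sub_left f]
  simp

lemma aux_log_taylor :
    Tendsto (fun x : ℝ => (Real.log (1 + x) - x) / x ^ 2) (𝓝[≠] 0) (𝓝 (-1/2)) := by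
  rw [tendsto_iff_norm_sub_tendsto_zero]
  have h1 : Tendsto (fun x : ℝ => |x| / (1 - |x|)) (𝓝[≠] 0) (𝓝 0) := by
    have : ContinuousAt (fun x : ℝ => |x| / (1 - |x|)) 0 := by
      apply ContinuousAt.div <;> first | fun_prop | simp
    have h := this.tendsto
    simp only [abs_zero, zero_div] at h
    exact h.mono_left nhdsWithin_le_nhds
  refine squeeze_zero' (Eventually.of_forall fun x => norm_nonneg _) ?_ h1
  have h2 : ∀ᶠ x : ℝ in 𝓝[≠] 0, |x| < 1 := by
    apply eventually_nhdsWithin_of_eventually_nhds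
    have : ContinuousAt (fun x : ℝ => |x|) 0 := by fun_prop
    exact this.eventually (gt_mem_nhds (by simp))
  filter_upwards [h2, self_mem_nhdsWithin] with x hx hx0
  have hx0 : x ≠ 0 := hx0
  have h3 := Real.abs_log_sub_add_sum_range_le (x := -x) (by simpa using hx) 2
  simp only [Finset.sum_range_succ, Finset.sum_range_zero, abs_neg] at h3
  norm_num at h3
  have e : (Real.log (1 + x) - x) / x ^ 2 - -1/2 = (-x + x ^ 2 / 2 + Real.log (1 + x)) / x ^ 2 := by
    field_simp; ring
  rw [Real.norm_eq_abs, e, abs_div, abs_of_nonneg (sq_nonneg x), div_le_iff₀ (by positivity)]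
  refine h3.trans (le_of_eq ?_)
  rw [← sq_abs x]; ring

lemma aux_one_sub_le {u : ℝ} (h0 : 0 ≤ u) (h1 : u < 1) :
    1 - u ≤ Real.exp (-u - u ^ 2 / 2) := by
  have h := Real.hasSum_pow_div_log_of_abs_lt_one (x := u) (by rw [abs_of_nonneg h0]; exact h1)
  have h2 := sum_le_hasSum (Finset.range 2) (fun i _ => by positivity) h
  simp only [Finset.sum_range_succ, Finset.sum_range_zero] at h2
  norm_num at h2
  rw [← Real.log_le_iff_le_exp (by linarith)]
  linarith

lemma aux_prod_bound {r u : ℝ} (hr : 0 < r) (h0 : 0 ≤ u) (h1 : u < 1) (k m : ℕ) :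
    (1 - u) ^ k * (1 + r * u) ^ m ≤ Real.exp (u * (r * m - k) - k * u ^ 2 / 2) := by
  have a1 : (1 - u) ^ k ≤ Real.exp (-u - u ^ 2 / 2) ^ k :=
    pow_le_pow_left₀ (by linarith) (aux_one_sub_le h0 h1) k
  have a2 : (1 + r * u) ^ m ≤ Real.exp (r * u) ^ m :=
    pow_le_pow_left₀ (by positivity) (by linarith [Real.add_one_le_exp (r * u)]) m
  calc _ ≤ Real.exp (-u - u ^ 2 / 2) ^ k * Real.exp (r * u) ^ m := by
        apply mul_le_mul a1 a2 (by positivity) (by positivity)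
    _ = _ := by
        rw [← Real.exp_nat_mul, ← Real.exp_nat_mul, ← Real.exp_add]; congr 1; ring

/-- pointwise limit for Laplace's method -/
lemma aux_pointwise (ν μ : ℝ) (hν : 0 < ν) (hμ : 0 < μ) (hs : ν + μ = 1) (k m : ℕ → ℕ)
    (hk : Tendsto (fun N : ℕ => (k N : ℝ) / N) atTop (𝓝 ν))
    (hm : Tendsto (fun N : ℕ => (m N : ℝ) / N) atTop (𝓝 μ))
    (hkm : Tendsto (fun N : ℕ => ((ν / μ) * m N - k N) / Real.sqrt N) atTop (𝓝 0))
    (a : ℕ → ℝ) (ha : ∀ N, 0 ≤ a N) (ha0 : Tendsto a atTop (𝓝 0))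
    (haN : Tendsto (fun N : ℕ => a N * N) atTop (𝓝 0)) (t : ℝ) (ht : 0 < t) :
    Tendsto (fun N : ℕ => (1 - t / Real.sqrt N) ^ (k N) * (1 + (ν / μ) * (t / Real.sqrt N)) ^ (m N)
      * (t / Real.sqrt N) ^ (a N)) atTop (𝓝 (Real.exp (- (ν / (2 * μ)) * t ^ 2))) := by
  have hsq : Tendsto (fun N : ℕ => Real.sqrt N) atTop atTop :=
    Real.tendsto_sqrt_atTop.comp tendsto_natCast_atTop_atTop
  have hu : Tendsto (fun N : ℕ => t / Real.sqrt N) atTop (𝓝 0) := hsq.const_div_atTop t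
  have hN : ∀ᶠ N : ℕ in atTop, 1 ≤ N := eventually_ge_atTop 1
  have hu1 : Tendsto (fun N : ℕ => -(t / Real.sqrt N)) atTop (𝓝[≠] 0) := by
    rw [tendsto_nhdsWithin_iff]
    refine ⟨by simpa using hu.neg, ?_⟩
    filter_upwards [hN] with N h
    have : 0 < Real.sqrt N := Real.sqrt_pos.2 (by exact_mod_cast h)
    simp; constructor <;> positivity
  have hu2 : Tendsto (fun N : ℕ => (ν / μ) * (t / Real.sqrt N)) atTop (𝓝[≠] 0) := by
    rw [tendsto_nhdsWithin_iff]
    refine ⟨by simpa using hu.const_mul (ν / μ), ?_⟩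
    filter_upwards [hN] with N h
    have : 0 < Real.sqrt N := Real.sqrt_pos.2 (by exact_mod_cast h)
    have : 0 < (ν / μ) * (t / Real.sqrt N) := by positivity
    exact this.ne'
  have l1 := aux_log_taylor.comp hu1
  have l2 := aux_log_taylor.comp hu2
  have l3 : Tendsto (fun N : ℕ => a N * Real.log N) atTop (𝓝 0) := by
    refine squeeze_zero' ?_ ?_ haN
    · filter_upwards [hN] with N h
      exact mul_nonneg (ha N) (Real.log_nonneg (by exact_mod_cast h))
    · filter_upwards with N
      exact mul_le_mul_of_nonneg_left (Real.log_le_self (by positivity)) (ha N)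
  have key : Tendsto (fun N : ℕ => t * (((ν / μ) * m N - k N) / Real.sqrt N)
      + ((k N : ℝ) / N) * t ^ 2 * ((Real.log (1 + -(t / Real.sqrt N)) - -(t / Real.sqrt N)) / (-(t / Real.sqrt N)) ^ 2)
      + ((m N : ℝ) / N) * ((ν / μ) ^ 2 * t ^ 2) * ((Real.log (1 + (ν / μ) * (t / Real.sqrt N)) - (ν / μ) * (t / Real.sqrt N)) / ((ν / μ) * (t / Real.sqrt N)) ^ 2)
      + (a N * Real.log t - (a N * Real.log N) / 2)) atTop
      (𝓝 (t * 0 + ν * t ^ 2 * (-1/2) + μ * ((ν / μ) ^ 2 * t ^ 2) * (-1/2) + (0 * Real.log t - 0 / 2))) := by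
    refine ((((hkm.const_mul t).add ((hk.mul_const _).mul l1)).add ((hm.mul_const _).mul l2))).add
      ((ha0.mul_const _).sub (l3.div_const 2))
  have e : t * 0 + ν * t ^ 2 * (-1/2) + μ * ((ν / μ) ^ 2 * t ^ 2) * (-1/2) + (0 * Real.log t - 0 / 2)
      = - (ν / (2 * μ)) * t ^ 2 := by
    have : μ = 1 - ν := by linarith
    field_simp
    rw [this]; ring
  rw [e] at key
  refine ((Real.continuous_exp.tendsto _).comp key).congr' ?_
  filter_upwards [hN, hu.eventually (gt_mem_nhds one_pos)] with N h hlt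
  have hN0 : (0:ℝ) < N := by exact_mod_cast h
  have hs0 : 0 < Real.sqrt N := Real.sqrt_pos.2 hN0
  have hss : (N:ℝ) = Real.sqrt N ^ 2 := (Real.sq_sqrt hN0.le).symm
  have p1 : 0 < 1 - t / Real.sqrt N := by linarith
  have p2 : 0 < 1 + (ν / μ) * (t / Real.sqrt N) := by positivity
  have p3 : 0 < t / Real.sqrt N := by positivity
  have q1 : (1 - t / Real.sqrt N) ^ (k N) = Real.exp (k N * Real.log (1 - t / Real.sqrt N)) := by
    rw [Real.exp_nat_mul, Real.exp_log p1]
  have q2 : (1 + (ν / μ) * (t / Real.sqrt N)) ^ (m N) = Real.exp (m N * Real.log (1 + (ν / μ) * (t / Real.sqrt N))) := by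
    rw [Real.exp_nat_mul, Real.exp_log p2]
  rw [q1, q2, Real.rpow_def_of_pos p3, ← Real.exp_add, ← Real.exp_add, Function.comp]
  congr 1
  rw [← sub_eq_add_neg, Real.log_div ht.ne' hs0.ne', Real.log_sqrt hN0.le]
  generalize Real.log (1 - t / Real.sqrt N) = A
  generalize Real.log (1 + (ν / μ) * (t / Real.sqrt N)) = A'
  generalize Real.log N = A''
  generalize Real.log t = A'''
  rw [hss]
  simp only [Real.sqrt_sq hs0.le]
  generalize Real.sqrt N = q at *
  field_simp
  ring

lemma aux_laplace (ν μ : ℝ) (hν : 0 < ν) (hμ : 0 < μ) (hs : ν + μ = 1) (k m : ℕ → ℕ)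
    (hk : Tendsto (fun N : ℕ => (k N : ℝ) / N) atTop (𝓝 ν))
    (hm : Tendsto (fun N : ℕ => (m N : ℝ) / N) atTop (𝓝 μ))
    (hkm : Tendsto (fun N : ℕ => ((ν / μ) * m N - k N) / Real.sqrt N) atTop (𝓝 0))
    (a : ℕ → ℝ) (ha : ∀ N, 0 ≤ a N) (ha0 : Tendsto a atTop (𝓝 0))
    (haN : Tendsto (fun N : ℕ => a N * N) atTop (𝓝 0)) :
    Tendsto (fun N : ℕ => Real.sqrt N * ∫ u in Set.Ioo (0:ℝ) 1,
        (1 - u) ^ (k N) * (1 + (ν / μ) * u) ^ (m N) * u ^ (a N)) atTop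
      (𝓝 (Real.sqrt (Real.pi / (ν / (2 * μ))) / 2)) := by
  rw [← integral_gaussian_Ioi]
  have hN : ∀ᶠ N : ℕ in atTop, 1 ≤ N := eventually_ge_atTop 1
  have hsq : Tendsto (fun N : ℕ => Real.sqrt N) atTop atTop :=
    Real.tendsto_sqrt_atTop.comp tendsto_natCast_atTop_atTop
  have main : Tendsto (fun N : ℕ => ∫ t in Set.Ioi (0:ℝ),
      Set.indicator (Set.Ioo 0 (Real.sqrt N)) (fun t => (1 - t / Real.sqrt N) ^ (k N) *
        (1 + (ν / μ) * (t / Real.sqrt N)) ^ (m N) * (t / Real.sqrt N) ^ (a N)) t) atTop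
      (𝓝 (∫ t in Set.Ioi (0:ℝ), Real.exp (- (ν / (2 * μ)) * t ^ 2))) := by
    refine tendsto_integral_filter_of_dominated_convergence
      (fun t => Real.exp (2 / ν) * Real.exp (- (ν / 8) * t ^ 2)) ?_ ?_ ?_ ?_
    · filter_upwards with N
      refine AEStronglyMeasurable.indicator ?_ measurableSet_Ioo
      apply Measurable.aestronglyMeasurable
      fun_prop
    · filter_upwards [hN, hk.eventually (lt_mem_nhds (half_lt_self hν)),
        hkm.eventually (gt_mem_nhds one_pos)] with N h h1 h2
      filter_upwards with t
      have hN0 : (0:ℝ) < N := by exact_mod_cast h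
      have hs0 : 0 < Real.sqrt N := Real.sqrt_pos.2 hN0
      by_cases htt : t ∈ Set.Ioo 0 (Real.sqrt N)
      swap
      · rw [Set.indicator_of_notMem htt, norm_zero]; positivity
      rw [Set.indicator_of_mem htt]
      have u0 : 0 < t / Real.sqrt N := div_pos htt.1 hs0
      have u1 : t / Real.sqrt N < 1 := (div_lt_one hs0).2 htt.2
      have p1 : 0 < 1 - t / Real.sqrt N := by linarith
      have b1 := aux_prod_bound (r := ν / μ) (by positivity) u0.le u1 (k N) (m N)
      have b2 : (t / Real.sqrt N) ^ (a N) ≤ 1 := Real.rpow_le_one u0.le u1.le (ha N)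
      rw [Real.norm_of_nonneg (by positivity)]
      refine (mul_le_of_le_one_right (by positivity) b2).trans (b1.trans ?_)
      rw [← Real.exp_add, Real.exp_le_exp]
      have e1 : t / Real.sqrt N * (ν / μ * m N - k N) = t * ((ν / μ * m N - k N) / Real.sqrt N) := by
        ring
      have e2 : (k N : ℝ) * (t / Real.sqrt N) ^ 2 / 2 = ((k N : ℝ) / N) * t ^ 2 / 2 := by
        rw [div_pow, Real.sq_sqrt hN0.le]; ring
      rw [e1, e2]
      have f1 : t * ((ν / μ * m N - k N) / Real.sqrt N) ≤ t * 1 :=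
        mul_le_mul_of_nonneg_left h2.le htt.1.le
      have f2 : ν / 2 * t ^ 2 ≤ ((k N : ℝ) / N) * t ^ 2 :=
        mul_le_mul_of_nonneg_right h1.le (sq_nonneg t)
      have f3 : 0 ≤ 2 / ν * (1 - ν * t / 4) ^ 2 := by positivity
      have f4 : 2 / ν * (1 - ν * t / 4) ^ 2 = 2 / ν - t + ν * t ^ 2 / 8 := by
        field_simp; ring
      linarith
    · exact ((integrable_exp_neg_mul_sq (by positivity : 0 < ν / 8)).const_mul _).integrableOn
    · refine (ae_restrict_iff' measurableSet_Ioi).2 (Eventually.of_forall fun t ht => ?_)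
      refine (aux_pointwise ν μ hν hμ hs k m hk hm hkm a ha ha0 haN t ht).congr' ?_
      filter_upwards [hsq.eventually_gt_atTop t] with N h
      rw [Set.indicator_of_mem (show t ∈ Set.Ioo 0 (Real.sqrt N) from ⟨ht, h⟩)]
  refine main.congr' ?_
  filter_upwards [hN] with N h
  have hs0 : 0 < Real.sqrt N := Real.sqrt_pos.2 (by exact_mod_cast h)
  rw [aux_scale _ hs0]

lemma aux_rpow_int {a : ℝ} (ha : 0 < a) (f : ℝ → ℝ) (hf : Continuous f) :
    IntegrableOn (fun u : ℝ => f u * u ^ (a - 1)) (Set.Ioo 0 1) := by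
  have h : IntervalIntegrable (fun u : ℝ => u ^ (a - 1)) volume 0 1 :=
    intervalIntegral.intervalIntegrable_rpow' (by linarith)
  have := (h.continuousOn_mul hf.continuousOn)
  rw [intervalIntegrable_iff_integrableOn_Ioo_of_le zero_le_one] at this
  exact this

lemma aux_rpow_val {a : ℝ} (ha : 0 < a) : a * ∫ u in Set.Ioo (0:ℝ) 1, u ^ (a - 1) = 1 := by
  rw [← integral_Ioc_eq_integral_Ioo, ← intervalIntegral.integral_of_le zero_le_one,
    integral_rpow (Or.inl (by linarith))]
  simp [ha.ne']

lemma aux_split {a : ℝ} (ha : 0 < a) (f : ℝ → ℝ) (hf : Continuous f) :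
    a * ∫ u in Set.Ioo (0:ℝ) 1, f u * u ^ (a - 1) =
      1 + a * ∫ u in Set.Ioo (0:ℝ) 1, (f u - 1) * u ^ (a - 1) := by
  have h1 := aux_rpow_int ha (fun u => f u - 1) (by fun_prop)
  have h2 := aux_rpow_int ha (fun u => 1) (by fun_prop)
  simp only [one_mul] at h2
  have h3 : ∫ u in Set.Ioo (0:ℝ) 1, f u * u ^ (a - 1) = (∫ u in Set.Ioo (0:ℝ) 1, u ^ (a - 1))
      + ∫ u in Set.Ioo (0:ℝ) 1, (f u - 1) * u ^ (a - 1) := by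
    rw [← integral_add h2 h1]
    congr 1; ext u; ring
  rw [h3, mul_add, aux_rpow_val ha]

lemma aux_near_one {a K : ℝ} (ha : 0 < a) (f : ℝ → ℝ) (hf : Continuous f)
    (hK : ∀ u ∈ Set.Ioo (0:ℝ) 1, |f u - 1| ≤ K * u) :
    |a * (∫ u in Set.Ioo (0:ℝ) 1, f u * u ^ (a - 1)) - 1| ≤ a * K := by
  rw [aux_split ha f hf, add_sub_cancel_left, abs_mul, abs_of_pos ha]
  refine mul_le_mul_of_nonneg_left ?_ ha.le
  rw [← Real.norm_eq_abs]
  have hb := norm_setIntegral_le_of_norm_le_const (μ := volume) (s := Set.Ioo (0:ℝ) 1)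
    (f := fun u => (f u - 1) * u ^ (a - 1)) (C := K) (by simp) ?_
  · simpa using hb
  · intro u hu
    have hKu := hK u hu
    have hK0 : 0 ≤ K := by
      have := (abs_nonneg _).trans hKu
      exact nonneg_of_mul_nonneg_left this hu.1
    rw [norm_mul, Real.norm_eq_abs, Real.norm_of_nonneg (Real.rpow_nonneg hu.1.le _)]
    calc _ ≤ K * u * u ^ (a - 1) := mul_le_mul_of_nonneg_right hKu (Real.rpow_nonneg hu.1.le _)
      _ = K * u ^ a := by
        rw [Real.rpow_sub_one hu.1.ne']; have := hu.1.ne'; field_simp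
      _ ≤ K := mul_le_of_le_one_right hK0 (Real.rpow_le_one hu.1.le hu.2.le ha.le)

lemma aux_exp_chord {u δ : ℝ} (h0 : 0 ≤ u) (h1 : u ≤ 1) : 
    Real.exp (u * δ) ≤ 1 + Real.exp δ * u := by
  have h := convexOn_exp.2 (Set.mem_univ 0) (Set.mem_univ δ) (sub_nonneg.2 h1) h0 (by ring)
  simp only [smul_eq_mul, mul_zero, zero_add, Real.exp_zero] at h
  linarith

lemma aux_prod_near_one {r u δ : ℝ} (hr : 0 < r) (h0 : 0 < u) (h1 : u < 1) (k m : ℕ)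
    (hδ : r * m - k ≤ δ) :
    |(1 - u) ^ k * (1 + r * u) ^ m - 1| ≤ (k + Real.exp δ) * u := by
  have b1 := aux_prod_bound hr h0.le h1 k m
  have b2 : Real.exp (u * (r * m - k) - k * u ^ 2 / 2) ≤ Real.exp (u * δ) := by
    rw [Real.exp_le_exp]
    have := mul_le_mul_of_nonneg_left hδ h0.le
    have : 0 ≤ (k:ℝ) * u ^ 2 / 2 := by positivity
    linarith
  have b3 := aux_exp_chord (δ := δ) h0.le h1.le
  have b4 := one_add_mul_le_pow (a := -u) (by linarith) k
  have b5 : (1:ℝ) ≤ (1 + r * u) ^ m := one_le_pow₀ (by nlinarith)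
  have b6 : (1 - u) ^ k ≤ (1 - u) ^ k * (1 + r * u) ^ m :=
    le_mul_of_one_le_right (pow_nonneg (by linarith) k) b5
  have b7 : 0 ≤ (k:ℝ) * u := by positivity
  have b8 : 0 ≤ Real.exp δ * u := by positivity
  rw [← sub_eq_add_neg] at b4
  rw [abs_le]; constructor <;> linarith

lemma aux_B0 (ν μ : ℝ) (hν : 0 < ν) (hμ : 0 < μ) (hs : ν + μ = 1)
    (a : ℕ → ℝ) (ha : ∀ N, 0 ≤ a N) (ha0 : Tendsto a atTop (𝓝 0)) :
    Tendsto (fun N : ℕ => N * ∫ u in Set.Ioo (0:ℝ) 1,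
        μ ^ N * ((1 + (ν / μ) * u) ^ N - 1) * u ^ (a N - 1)) atTop (𝓝 (1 / ν)) := by
  have hlim : ∫ s in Set.Ioi (0:ℝ), Real.exp (-ν * s) = 1 / ν := by
    rw [integral_exp_mul_Ioi (by linarith)]; simp
  rw [← hlim]
  have hN : ∀ᶠ N : ℕ in atTop, 1 ≤ N := eventually_ge_atTop 1
  have hpow : ∀ (N : ℕ) (u : ℝ), μ ^ N * ((1 + (ν / μ) * u) ^ N - 1) = (μ + ν * u) ^ N - μ ^ N := by
    intro N u
    rw [mul_sub, ← mul_pow, mul_one]; congr 2; field_simp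
  have main : Tendsto (fun N : ℕ => ∫ s in Set.Ioi (0:ℝ),
      Set.indicator (Set.Ioo 0 (N:ℝ)) (fun s => ((μ + ν * (1 - s / N)) ^ N - μ ^ N) *
        (1 - s / N) ^ (a N - 1)) s) atTop
      (𝓝 (∫ s in Set.Ioi (0:ℝ), Real.exp (-ν * s))) := by
    refine tendsto_integral_filter_of_dominated_convergence
      (fun s => 2 * Real.exp (- (ν / 2) * s)) ?_ ?_ ?_ ?_
    · filter_upwards with N
      refine AEStronglyMeasurable.indicator ?_ measurableSet_Ioo
      apply Measurable.aestronglyMeasurable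
      fun_prop
    · filter_upwards [hN] with N h
      filter_upwards with s
      have hN0 : (0:ℝ) < N := by exact_mod_cast h
      by_cases htt : s ∈ Set.Ioo 0 (N:ℝ)
      swap
      · rw [Set.indicator_of_notMem htt, norm_zero]; positivity
      rw [Set.indicator_of_mem htt]
      obtain ⟨s0, s1⟩ := htt
      have w0 : 0 < s / N := by positivity
      have w1 : s / N < 1 := (div_lt_one hN0).2 s1
      obtain ⟨u, hu⟩ : ∃ u, u = 1 - s / N := ⟨_, rfl⟩
      rw [← hu]
      have u0 : 0 < u := by linarith
      have u1 : u < 1 := by linarith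
      have g0 : 0 ≤ (μ + ν * u) ^ N - μ ^ N := by
        rw [sub_nonneg]; exact pow_le_pow_left₀ hμ.le (by nlinarith) N
      have g1 : (μ + ν * u) ^ N - μ ^ N ≤ 2 * Real.exp (- (ν / 2) * s) * u := by
        rcases le_total u (1/2) with hle | hle
        · have hc := (convexOn_pow (𝕜 := ℝ) N).2 (Set.mem_Ici.2 hμ.le)
            (Set.mem_Ici.2 (by positivity : (0:ℝ) ≤ μ + ν / 2))
            (by linarith : 0 ≤ 1 - 2 * u) (by linarith : 0 ≤ 2 * u) (by ring)
          simp only [smul_eq_mul] at hc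
          have e : (1 - 2 * u) * μ + 2 * u * (μ + ν / 2) = μ + ν * u := by ring
          rw [e] at hc
          have hp : 0 ≤ μ ^ N := by positivity
          have hx : (μ + ν / 2) ^ N ≤ Real.exp (- (ν / 2) * s) := by
            calc (μ + ν / 2) ^ N ≤ Real.exp (- (ν / 2)) ^ N := by
                  apply pow_le_pow_left₀ (by positivity)
                  linarith [Real.add_one_le_exp (-(ν / 2))]
              _ = Real.exp (N * (- (ν / 2))) := by rw [Real.exp_nat_mul]
              _ ≤ _ := by rw [Real.exp_le_exp]; nlinarith
          nlinarith
        · have hx : (μ + ν * u) ^ N ≤ Real.exp (- (ν / 2) * s) := by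
            calc (μ + ν * u) ^ N ≤ Real.exp (- (ν * (s / N))) ^ N := by
                  apply pow_le_pow_left₀ (by positivity)
                  have := Real.add_one_le_exp (- (ν * (s / N)))
                  rw [hu]; nlinarith
              _ = Real.exp (N * (- (ν * (s / N)))) := by rw [Real.exp_nat_mul]
              _ ≤ _ := by
                rw [Real.exp_le_exp]
                have : N * (- (ν * (s / N))) = - (ν * s) := by field_simp
                rw [this]; nlinarith
          have hp : 0 ≤ μ ^ N := by positivity
          have he := Real.exp_pos (- (ν / 2) * s)
          nlinarith
      rw [Real.norm_of_nonneg (mul_nonneg g0 (Real.rpow_nonneg u0.le _)), Real.rpow_sub_one u0.ne']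
      have b2 : u ^ (a N) ≤ 1 := Real.rpow_le_one u0.le u1.le (ha N)
      have b3 : 0 ≤ u ^ (a N) := Real.rpow_nonneg u0.le _
      calc _ = (((μ + ν * u) ^ N - μ ^ N) / u) * u ^ (a N) := by ring
        _ ≤ ((μ + ν * u) ^ N - μ ^ N) / u := mul_le_of_le_one_right (by positivity) b2
        _ ≤ _ := (div_le_iff₀ u0).2 g1
    · exact ((exp_neg_integrableOn_Ioi 0 (by positivity : 0 < ν / 2)).const_mul _)
    · refine (ae_restrict_iff' measurableSet_Ioi).2 (Eventually.of_forall fun s hs0 => ?_)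
      have l0 : Tendsto (fun N : ℕ => 1 - s / (N:ℝ)) atTop (𝓝 1) := by
        simpa using (tendsto_const_div_atTop_nhds_zero_nat s).const_sub 1
      have l1 := l0.rpow (ha0.sub_const 1) (Or.inl one_ne_zero)
      rw [Real.one_rpow] at l1
      have l2 := (Real.tendsto_one_add_div_pow_exp (-ν * s)).sub
        (tendsto_pow_atTop_nhds_zero_of_lt_one hμ.le (by linarith))
      have l3 := l2.mul l1
      rw [sub_zero, mul_one] at l3
      refine l3.congr' ?_
      filter_upwards [tendsto_natCast_atTop_atTop.eventually_gt_atTop s] with N h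
      rw [Set.indicator_of_mem (show s ∈ Set.Ioo 0 (N:ℝ) from ⟨hs0, h⟩)]
      congr 3
      have : μ = 1 - ν := by linarith
      rw [this]; ring
  refine main.congr' ?_
  filter_upwards [hN] with N h
  have hN0 : (0:ℝ) < N := by exact_mod_cast h
  rw [aux_reflect, aux_scale _ hN0]
  simp only [hpow]

lemma aux_tendsto_one (μ α r : ℝ) (hμ : 0 < μ) (hμ1 : μ < 1) (hα : 0 < α) (hr : 0 < r)
    (k m : ℕ → ℕ) (hk : ∀ᶠ N in atTop, k N ≤ N)
    (hkm : ∀ ε > 0, ∀ᶠ N : ℕ in atTop, r * m N - k N ≤ ε * N) 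
    (a : ℕ → ℝ) (ha : ∀ N : ℕ, a N = α * N * μ ^ N) :
    Tendsto (fun N : ℕ => a N * ∫ u in Set.Ioo (0:ℝ) 1,
        (1 - u) ^ (k N) * (1 + r * u) ^ (m N) * u ^ (a N - 1)) atTop (𝓝 1) := by
  have hl : Real.log μ < 0 := Real.log_neg hμ hμ1
  obtain ⟨ε, hε⟩ : ∃ ε, ε = - Real.log μ / 2 := ⟨_, rfl⟩
  have hε0 : 0 < ε := by linarith
  have hq1 : μ * Real.exp ε < 1 := by
    rw [← Real.exp_log hμ, ← Real.exp_add, Real.exp_lt_one_iff]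
    linarith
  have t1 := (tendsto_pow_const_mul_const_pow_of_lt_one 2 hμ.le hμ1).const_mul α
  have t2 := (tendsto_pow_const_mul_const_pow_of_lt_one 1 (r := μ * Real.exp ε) (by positivity)
    hq1).const_mul α
  have t3 := t1.add t2
  simp only [mul_zero, add_zero] at t3
  rw [tendsto_iff_norm_sub_tendsto_zero]
  refine squeeze_zero' (Eventually.of_forall fun N => norm_nonneg _) ?_ t3
  filter_upwards [hk, hkm ε hε0, eventually_ge_atTop 1] with N h1 h2 h3
  have hN0 : (0:ℝ) < N := by exact_mod_cast h3
  have ha0 : 0 < a N := by rw [ha]; positivity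
  rw [Real.norm_eq_abs]
  refine (aux_near_one ha0 (fun u => (1 - u) ^ (k N) * (1 + r * u) ^ (m N)) (by fun_prop)
    (fun u hu => aux_prod_near_one hr hu.1 hu.2 (k N) (m N) h2)).trans ?_
  have h1' : (k N : ℝ) ≤ N := by exact_mod_cast h1
  calc a N * (k N + Real.exp (ε * N)) ≤ a N * (N + Real.exp (ε * N)) := by gcongr
    _ = _ := by
      rw [ha, mul_comm ε, Real.exp_nat_mul, mul_pow]; ring

/-- Critical regime (Proposition 11): convergence of the Laplace transform
`E_{C_N}(e^{-α_N T_0})` to `2ν/(2ν+α)` with `α_N = α N (1-ν)^N`. -/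
theorem critical_empty_state_laplace_limit
    (ν μ α : ℝ) (hν : ν ∈ Set.Ioo (0:ℝ) 1) (hμ : μ = 1 - ν) (hα : 0 < α)
    (C : ℕ → ℕ)
    (hC1 : ∀ᶠ N in atTop, 1 ≤ C N ∧ C N + 1 ≤ N)
    (hC : (fun N : ℕ => (C N : ℝ) - ν * N) =o[atTop] fun N : ℕ => Real.sqrt N)
    (αN : ℕ → ℝ) (hαN : ∀ N : ℕ, αN N = α * N * (1 - ν) ^ N)
    (B D : ℕ → ℕ → ℝ)
    (hB : ∀ N x, B N x = ∫ u in Set.Ioo (0:ℝ) 1,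
        (1 - u) ^ x * (1 + (ν / μ) * u) ^ (N - x) * u ^ (αN N - 1))
    (hD : ∀ N x, D N x = ∫ u in Set.Ioo (0:ℝ) 1,
        (1 - u) ^ (N - x) * (1 + (μ / ν) * u) ^ x * u ^ (αN N - 1))
    (b d : ℕ → ℝ)
    (hb : ∀ N, b N = ν * ∫ u in Set.Ioo (0:ℝ) 1,
        (1 - u) ^ (C N) * (1 + (ν / μ) * u) ^ (N - C N - 1) * u ^ (αN N))
    (hd : ∀ N, d N = μ * ∫ u in Set.Ioo (0:ℝ) 1,
        (1 - u) ^ (N - C N - 1) * (1 + (μ / ν) * u) ^ (C N) * u ^ (αN N)) :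
    Tendsto (fun N : ℕ =>
        (d N * B N (C N) + b N * D N (C N)) / (d N * B N 0 + b N * D N 0))
      atTop (𝓝 (2 * ν / (2 * ν + α))) := by
  obtain ⟨hν0, hν1⟩ := hν
  have hμ0 : 0 < μ := by linarith
  have hμ1 : μ < 1 := by linarith
  have hs : ν + μ = 1 := by linarith
  rw [← hμ] at hαN
  have hge : ∀ᶠ N : ℕ in atTop, 1 ≤ N := eventually_ge_atTop 1
  have hsq : Tendsto (fun N : ℕ => Real.sqrt N) atTop atTop :=
    Real.tendsto_sqrt_atTop.comp tendsto_natCast_atTop_atTop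
  -- the deviation of `C N`
  have hC0 : Tendsto (fun N : ℕ => ((C N : ℝ) - ν * N) / Real.sqrt N) atTop (𝓝 0) :=
    hC.tendsto_div_nhds_zero
  have hinv : Tendsto (fun N : ℕ => 1 / Real.sqrt N) atTop (𝓝 0) := hsq.const_div_atTop 1
  have hCN : Tendsto (fun N : ℕ => ((C N : ℝ) - ν * N) / N) atTop (𝓝 0) := by
    have := hC0.mul hinv
    rw [zero_mul] at this
    refine this.congr' ?_
    filter_upwards [hge] with N h
    have hN0 : (0:ℝ) < N := by exact_mod_cast h
    rw [div_mul_div_comm, Real.mul_self_sqrt hN0.le, mul_one]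
  have hk : Tendsto (fun N : ℕ => (C N : ℝ) / N) atTop (𝓝 ν) := by
    have := hCN.add_const ν
    rw [zero_add] at this
    refine this.congr' ?_
    filter_upwards [hge] with N h
    have hN0 : (0:ℝ) < N := by exact_mod_cast h
    field_simp; ring
  have hsub : ∀ᶠ N : ℕ in atTop, ((N - C N - 1 : ℕ) : ℝ) = N - C N - 1 := by
    filter_upwards [hC1] with N h
    rw [Nat.cast_sub (by omega), Nat.cast_sub (by omega)]; simp
  have hm : Tendsto (fun N : ℕ => ((N - C N - 1 : ℕ) : ℝ) / N) atTop (𝓝 μ) := by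
    have := (hk.const_sub 1).sub (tendsto_const_div_atTop_nhds_zero_nat (1:ℝ))
    rw [sub_zero, ← hμ] at this
    refine this.congr' ?_
    filter_upwards [hge, hsub] with N h h2
    have hN0 : (0:ℝ) < N := by exact_mod_cast h
    rw [h2]; field_simp
  have hkm1 : Tendsto (fun N : ℕ => ((ν / μ) * ((N - C N - 1 : ℕ) : ℝ) - C N) / Real.sqrt N)
      atTop (𝓝 0) := by
    have := (hC0.const_mul (-(1 / μ))).sub (hinv.const_mul (ν / μ))
    simp only [mul_zero, sub_zero] at this
    refine this.congr' ?_
    filter_upwards [hge, hsub] with N h h2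
    have hs0 : 0 < Real.sqrt N := Real.sqrt_pos.2 (by exact_mod_cast h)
    rw [h2, hμ]; rw [hμ] at hμ0; field_simp; ring
  have hkm2 : Tendsto (fun N : ℕ => ((μ / ν) * (C N : ℝ) - ((N - C N - 1 : ℕ) : ℝ)) / Real.sqrt N)
      atTop (𝓝 0) := by
    have := (hC0.const_mul (1 / ν)).add hinv
    simp only [mul_zero, add_zero] at this
    refine this.congr' ?_
    filter_upwards [hge, hsub] with N h h2
    have hs0 : 0 < Real.sqrt N := Real.sqrt_pos.2 (by exact_mod_cast h)
    rw [h2, hμ]; field_simp; ring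
  -- `αN`
  have ha : ∀ N, 0 ≤ αN N := fun N => by rw [hαN]; positivity
  have ha0 : Tendsto αN atTop (𝓝 0) := by
    have := (tendsto_pow_const_mul_const_pow_of_lt_one 1 hμ0.le hμ1).const_mul α
    rw [mul_zero] at this
    refine this.congr fun N => ?_
    rw [hαN]; ring
  have haN : Tendsto (fun N : ℕ => αN N * N) atTop (𝓝 0) := by
    have := (tendsto_pow_const_mul_const_pow_of_lt_one 2 hμ0.le hμ1).const_mul α
    rw [mul_zero] at this
    refine this.congr fun N => ?_
    rw [hαN]; ring
  -- `b` and `d`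
  obtain ⟨L, hL⟩ : ∃ L, L = ν * (Real.sqrt (Real.pi / (ν / (2 * μ))) / 2) := ⟨_, rfl⟩
  have hL0 : 0 < L := by rw [hL]; have := Real.pi_pos; positivity
  have hL' : L = μ * (Real.sqrt (Real.pi / (μ / (2 * ν))) / 2) := by
    have hpi := Real.pi_pos
    have e1 : ν * Real.sqrt (Real.pi / (ν / (2 * μ))) = Real.sqrt (2 * Real.pi * ν * μ) := by
      rw [← Real.sqrt_sq hν0.le, ← Real.sqrt_mul (by positivity), Real.sqrt_sq hν0.le]
      congr 1; field_simp
    have e2 : μ * Real.sqrt (Real.pi / (μ / (2 * ν))) = Real.sqrt (2 * Real.pi * ν * μ) := by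
      rw [← Real.sqrt_sq hμ0.le, ← Real.sqrt_mul (by positivity), Real.sqrt_sq hμ0.le]
      congr 1; field_simp
    rw [hL, ← mul_div_assoc, ← mul_div_assoc, e1, e2]
  have hbL : Tendsto (fun N : ℕ => Real.sqrt N * b N) atTop (𝓝 L) := by
    rw [hL]
    refine ((aux_laplace ν μ hν0 hμ0 hs C (fun N => N - C N - 1) hk hm hkm1 αN ha ha0
      haN).const_mul ν).congr fun N => ?_
    rw [hb]; ring
  have hdL : Tendsto (fun N : ℕ => Real.sqrt N * d N) atTop (𝓝 L) := by
    rw [hL']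
    refine ((aux_laplace μ ν hμ0 hν0 (by linarith) (fun N => N - C N - 1) C hm hk hkm2 αN ha ha0
      haN).const_mul μ).congr fun N => ?_
    rw [hd]; ring
  -- `B` and `D`
  have hCle : ∀ᶠ N in atTop, C N ≤ N := hC1.mono fun N h => by omega
  have hP : Tendsto (fun N : ℕ => αN N * B N (C N)) atTop (𝓝 1) := by
    simp only [hB]
    refine aux_tendsto_one μ α (ν / μ) hμ0 hμ1 hα (by positivity) C (fun N => N - C N) hCle
      (fun ε hε => ?_) αN hαN
    have := hCN.const_mul (-(1 / μ))
    rw [mul_zero] at this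
    filter_upwards [hge, hCle, this.eventually (gt_mem_nhds hε)] with N h h1 h2
    have hN0 : (0:ℝ) < N := by exact_mod_cast h
    rw [Nat.cast_sub h1]
    have e : ν / μ * ((N:ℝ) - C N) - C N = -(1 / μ) * ((C N - ν * N) / N) * N := by
      rw [hμ]; rw [hμ] at hμ0; field_simp; ring
    rw [e]
    exact mul_le_mul_of_nonneg_right h2.le hN0.le
  have hQ : Tendsto (fun N : ℕ => αN N * D N (C N)) atTop (𝓝 1) := by
    simp only [hD]
    refine aux_tendsto_one μ α (μ / ν) hμ0 hμ1 hα (by positivity) (fun N => N - C N) C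
      (Eventually.of_forall fun N => by omega) (fun ε hε => ?_) αN hαN
    have := hCN.const_mul (1 / ν)
    rw [mul_zero] at this
    filter_upwards [hge, hCle, this.eventually (gt_mem_nhds hε)] with N h h1 h2
    have hN0 : (0:ℝ) < N := by exact_mod_cast h
    rw [Nat.cast_sub h1]
    have e : μ / ν * (C N : ℝ) - (N - C N) = (1 / ν) * ((C N - ν * N) / N) * N := by
      rw [hμ]; field_simp; ring
    rw [e]
    exact mul_le_mul_of_nonneg_right h2.le hN0.le
  have hS : Tendsto (fun N : ℕ => αN N * D N 0) atTop (𝓝 1) := by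
    simp only [hD]
    refine aux_tendsto_one μ α (μ / ν) hμ0 hμ1 hα (by positivity) (fun N => N - 0) (fun _ => 0)
      (Eventually.of_forall fun N => by omega) (fun ε hε => ?_) αN hαN
    filter_upwards with N
    have : 0 ≤ ε * N := by positivity
    have : (0:ℝ) ≤ N := by positivity
    simp; linarith
  have hR : Tendsto (fun N : ℕ => αN N * B N 0) atTop (𝓝 (1 + α * (1 / ν))) := by
    refine (((aux_B0 ν μ hν0 hμ0 hs αN ha ha0).const_mul α).const_add 1).congr' ?_
    filter_upwards [hge] with N h
    have hN0 : (0:ℝ) < N := by exact_mod_cast h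
    have hpos : 0 < αN N := by rw [hαN]; positivity
    rw [hB]
    simp only [pow_zero, one_mul, Nat.sub_zero]
    rw [aux_split hpos (fun u => (1 + ν / μ * u) ^ N) (by fun_prop)]
    simp only [mul_assoc]
    rw [integral_const_mul]
    generalize (∫ u in Set.Ioo (0:ℝ) 1, ((1 + ν / μ * u) ^ N - 1) * u ^ (αN N - 1)) = I
    rw [hαN]
    ring
  have key := ((hdL.mul hP).add (hbL.mul hQ)).div ((hdL.mul hR).add (hbL.mul hS)) (by positivity)
  have e : (L * 1 + L * 1) / (L * (1 + α * (1 / ν)) + L * 1) = 2 * ν / (2 * ν + α) := by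
    field_simp; ring
  rw [e] at key
  refine key.congr' ?_
  filter_upwards [hge] with N h
  have hN0 : (0:ℝ) < N := by exact_mod_cast h
  have hpos : 0 < αN N := by rw [hαN]; positivity
  have hs0 : 0 < Real.sqrt N := Real.sqrt_pos.2 hN0
  simp only [Pi.div_apply]
  rw [show Real.sqrt N * d N * (αN N * B N (C N)) + Real.sqrt N * b N * (αN N * D N (C N))
      = (Real.sqrt N * αN N) * (d N * B N (C N) + b N * D N (C N)) by ring,
    show Real.sqrt N * d N * (αN N * B N 0) + Real.sqrt N * b N * (αN N * D N 0)
      = (Real.sqrt N * αN N) * (d N * B N 0 + b N * D N 0) by ring,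
    mul_div_mul_left _ _ (by positivity)]
end

section
/- Let ν ∈ (0,1), μ = 1 − ν, α > 0, let (C_N) be a sequence of integers with 1 ≤ C_N ≤ N−1 and C_N = νN + o(√N), and set α_N = α·N·(1−ν)^N. Then lim_{N→∞} √N · μ ∫₀¹ (1−u)^{N−C_N−1} (1 + (μ/ν)u)^{C_N} u^{α_N} du = √(π·ν·(1−ν)/2). -/
open Filter Topology MeasureTheory Asymptotics

/-- second order expansion of the logarithm along `c / s`. -/
lemma aux_log_limit (c : ℝ) :
    Tendsto (fun s : ℝ => s ^ 2 * (Real.log (1 - c / s) + c / s)) atTop (𝓝 (-(c ^ 2 / 2))) := by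
  have h0 : Tendsto (fun s : ℝ => c / s) atTop (𝓝 0) := tendsto_const_nhds.div_atTop tendsto_id
  have h1 : Tendsto (fun s : ℝ => |c| ^ 2 * (|c / s| / (1 - |c / s|))) atTop (𝓝 0) := by
    have h2 : Tendsto (fun s : ℝ => |c / s|) atTop (𝓝 0) := by simpa using h0.abs
    have h3 := (h2.div (tendsto_const_nhds.sub h2 : Tendsto (fun s : ℝ => 1 - |c / s|) atTop _)
      (by norm_num)).const_mul (|c| ^ 2)
    simpa using h3
  rw [tendsto_iff_norm_sub_tendsto_zero]
  refine squeeze_zero' (Eventually.of_forall fun _ => norm_nonneg _) ?_ h1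
  have h4 : ∀ᶠ s : ℝ in atTop, |c / s| < 1 := by
    have h2 : Tendsto (fun s : ℝ => |c / s|) atTop (𝓝 0) := by simpa using h0.abs
    exact h2.eventually_lt_const one_pos
  filter_upwards [h4, eventually_gt_atTop 0] with s hs hs0
  have h := Real.abs_log_sub_add_sum_range_le hs 2
  simp only [Finset.sum_range_succ, Finset.sum_range_zero] at h
  norm_num at h
  have e : s ^ 2 * (Real.log (1 - c / s) + c / s) - -(c ^ 2 / 2)
      = s ^ 2 * (c / s + (c / s) ^ 2 / 2 + Real.log (1 - c / s)) := by
    field_simp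
    ring
  rw [e, Real.norm_eq_abs, abs_mul, abs_of_nonneg (sq_nonneg s)]
  calc _ ≤ s ^ 2 * (|c / s| ^ 3 / (1 - |c / s|)) := by
        gcongr
    _ = _ := by
        have : |c| ^ 2 = s ^ 2 * |c / s| ^ 2 := by
          rw [abs_div, abs_of_pos hs0]; field_simp
        rw [this]; ring

lemma aux_log_bound {u : ℝ} (h0 : 0 < u) (h1 : u < 1) : Real.log (1 - u) ≤ -u - u ^ 2 / 2 := by
  have h := Real.hasSum_pow_div_log_of_abs_lt_one (x := u) (by rw [abs_of_pos h0]; exact h1)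
  have := h.summable.sum_le_tsum (Finset.range 2) (fun i _ => by positivity)
  rw [h.tsum_eq] at this
  simp only [Finset.sum_range_succ, Finset.sum_range_zero] at this
  norm_num at this
  linarith

theorem critical_dN_asymptotics
    (ν μ α : ℝ) (hν : ν ∈ Set.Ioo (0:ℝ) 1) (hμ : μ = 1 - ν) (hα : 0 < α)
    (C : ℕ → ℕ)
    (hC1 : ∀ᶠ N in atTop, 1 ≤ C N ∧ C N + 1 ≤ N)
    (hC : (fun N : ℕ => (C N : ℝ) - ν * N) =o[atTop] fun N : ℕ => Real.sqrt N)
    (αN : ℕ → ℝ) (hαN : ∀ N : ℕ, αN N = α * N * (1 - ν) ^ N) :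
    Tendsto (fun N : ℕ =>
        Real.sqrt N * (μ * ∫ u in Set.Ioo (0:ℝ) 1,
          (1 - u) ^ (N - C N - 1) * (1 + (μ / ν) * u) ^ (C N) * u ^ (αN N)))
      atTop (𝓝 (Real.sqrt (Real.pi * ν * (1 - ν) / 2))) := by
  obtain ⟨hν0, hν1⟩ := hν
  have hμ0 : 0 < μ := by rw [hμ]; linarith
  have hr : 0 < μ / ν := by positivity
  have hα0 : ∀ N, 0 ≤ αN N := fun N => by
    rw [hαN, ← hμ]; positivity
  have hs : Tendsto (fun N : ℕ => Real.sqrt N) atTop atTop :=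
    Real.tendsto_sqrt_atTop.comp tendsto_natCast_atTop_atTop
  have hsi : Tendsto (fun N : ℕ => (Real.sqrt N)⁻¹) atTop (𝓝 0) := tendsto_inv_atTop_zero.comp hs
  set δ : ℕ → ℝ := fun N => ((C N : ℝ) - ν * N) / Real.sqrt N with hδ
  have hδ0 : Tendsto δ atTop (𝓝 0) := hC.tendsto_div_nhds_zero
  -- basic eventual identities
  have hbasic : ∀ᶠ N : ℕ in atTop, 0 < Real.sqrt N ∧
      (C N : ℝ) = ν * Real.sqrt N ^ 2 + δ N * Real.sqrt N ∧
      ((N - C N - 1 : ℕ) : ℝ) = μ * Real.sqrt N ^ 2 - δ N * Real.sqrt N - 1 := by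
    filter_upwards [hC1, hs.eventually_gt_atTop 0] with N hN hsN
    have h2 : Real.sqrt N ^ 2 = N := Real.sq_sqrt (Nat.cast_nonneg N)
    have h3 : δ N * Real.sqrt N = (C N : ℝ) - ν * N := by
      simp only [hδ]; field_simp
    refine ⟨hsN, by rw [h2, h3]; ring, ?_⟩
    rw [Nat.sub_sub, Nat.cast_sub hN.2, h2, h3, hμ]
    push_cast; ring
  -- the power of u
  have hαlog : Tendsto (fun N : ℕ => αN N * Real.log (Real.sqrt N)) atTop (𝓝 0) := by
    have hg : Tendsto (fun N : ℕ => α * ((N : ℝ) ^ 2 * μ ^ N)) atTop (𝓝 0) := by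
      simpa using (tendsto_pow_const_mul_const_pow_of_lt_one 2 hμ0.le (by linarith)).const_mul α
    refine squeeze_zero' ?_ ?_ hg
    · filter_upwards [hs.eventually_ge_atTop 1] with N hN
      exact mul_nonneg (hα0 N) (Real.log_nonneg hN)
    · filter_upwards [hs.eventually_ge_atTop 1] with N hN
      have h2 : Real.sqrt N ^ 2 = N := Real.sq_sqrt (Nat.cast_nonneg N)
      have h3 : Real.log (Real.sqrt N) ≤ N := by
        have := Real.log_le_sub_one_of_pos (by linarith : 0 < Real.sqrt N)
        nlinarith
      calc _ ≤ αN N * N := mul_le_mul_of_nonneg_left h3 (hα0 N)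
        _ = _ := by rw [hαN, ← hμ]; ring
  have hαlim : Tendsto αN atTop (𝓝 0) := by
    have := (tendsto_pow_const_mul_const_pow_of_lt_one 1 hμ0.le (by linarith)).const_mul α
    simp only [mul_zero, pow_one] at this
    refine this.congr fun N => ?_
    rw [hαN, ← hμ]; ring
  set G : ℕ → ℝ → ℝ := fun N u =>
    (1 - u) ^ (N - C N - 1) * (1 + (μ / ν) * u) ^ (C N) * u ^ (αN N) with hG
  set F : ℕ → ℝ → ℝ := fun N x => (Set.Ioo (0:ℝ) 1).indicator (G N) (x / Real.sqrt N) with hF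
  have hGexp : ∀ᶠ N : ℕ in atTop, ∀ x : ℝ, x / Real.sqrt N ∈ Set.Ioo (0:ℝ) 1 →
      (1 - x / Real.sqrt N) ^ (N - C N - 1) * (1 + (μ / ν) * (x / Real.sqrt N)) ^ (C N) =
      Real.exp (((N - C N - 1 : ℕ) : ℝ) * (Real.log (1 - x / Real.sqrt N) + x / Real.sqrt N)
        + C N * (Real.log (1 + (μ / ν) * (x / Real.sqrt N)) - (μ / ν) * (x / Real.sqrt N))
        + x * (δ N / ν + (Real.sqrt N)⁻¹)) := by
    filter_upwards [hbasic] with N hN x hx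
    obtain ⟨h1, h2, h3⟩ := hN
    have p1 : 0 < 1 - x / Real.sqrt N := by linarith [hx.2]
    have p2 : 0 < 1 + (μ / ν) * (x / Real.sqrt N) := by
      have := mul_pos hr hx.1
      linarith
    have e : x * (δ N / ν + (Real.sqrt N)⁻¹)
        = (C N * (μ / ν) - ((N - C N - 1 : ℕ) : ℝ)) * (x / Real.sqrt N) := by
      rw [h2, h3]
      have : μ = 1 - ν := hμ
      subst this
      field_simp
      ring
    rw [e, ← Real.exp_log (pow_pos p1 (N - C N - 1)), ← Real.exp_log (pow_pos p2 (C N)),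
      ← Real.exp_add, Real.log_pow, Real.log_pow]
    congr 1
    ring
  -- domination
  have hbound : ∀ᶠ N : ℕ in atTop, ∀ᵐ x : ℝ,
      ‖F N x‖ ≤ Real.exp (2 / μ) * Real.exp (-(μ / 8) * x ^ 2) := by
    have hA : Tendsto (fun N : ℕ => δ N / ν + (Real.sqrt N)⁻¹) atTop (𝓝 0) := by
      simpa using (hδ0.div_const ν).add hsi
    have hB : Tendsto (fun N : ℕ => μ - δ N * (Real.sqrt N)⁻¹ - (Real.sqrt N)⁻¹ ^ 2)
        atTop (𝓝 μ) := by
      simpa using (tendsto_const_nhds.sub (hδ0.mul hsi) :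
        Tendsto (fun N : ℕ => μ - δ N * (Real.sqrt N)⁻¹) atTop _).sub (hsi.pow 2)
    filter_upwards [hbasic, hGexp, hA.eventually_lt_const one_pos,
      hB.eventually_const_lt (half_lt_self hμ0)] with N hN hE hA hB
    refine Eventually.of_forall fun x => ?_
    obtain ⟨h1, h2, h3⟩ := hN
    by_cases hx : x / Real.sqrt N ∈ Set.Ioo (0:ℝ) 1
    · have hx0 : 0 < x := by
        have := mul_pos hx.1 h1
        rwa [div_mul_cancel₀ _ h1.ne'] at this
      have hpw : (x / Real.sqrt N) ^ (αN N) ≤ 1 := Real.rpow_le_one hx.1.le hx.2.le (hα0 N)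
      have hpw0 : 0 ≤ (x / Real.sqrt N) ^ (αN N) := Real.rpow_nonneg hx.1.le _
      simp only [hF, Set.indicator_of_mem hx, hG]
      rw [hE x hx, Real.norm_of_nonneg (by positivity), ← Real.exp_add]
      refine (mul_le_of_le_one_right (Real.exp_pos _).le hpw).trans (Real.exp_le_exp.2 ?_)
      have l1 := aux_log_bound hx.1 hx.2
      have l2 : Real.log (1 + (μ / ν) * (x / Real.sqrt N)) ≤ (μ / ν) * (x / Real.sqrt N) := by
        have := Real.log_le_sub_one_of_pos
          (by have := mul_pos hr hx.1; linarith : 0 < 1 + (μ / ν) * (x / Real.sqrt N))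
        linarith
      have t1 : ((N - C N - 1 : ℕ) : ℝ) * (Real.log (1 - x / Real.sqrt N) + x / Real.sqrt N)
          ≤ -(μ / 4) * x ^ 2 := by
        calc _ ≤ ((N - C N - 1 : ℕ) : ℝ) * (-((x / Real.sqrt N) ^ 2 / 2)) :=
              mul_le_mul_of_nonneg_left (by linarith) (Nat.cast_nonneg _)
          _ = -((μ - δ N * (Real.sqrt N)⁻¹ - (Real.sqrt N)⁻¹ ^ 2) * (x ^ 2 / 2)) := by
              rw [h3]; field_simp
          _ ≤ -(μ / 2 * (x ^ 2 / 2)) := by gcongr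
          _ = _ := by ring
      have t2 : C N * (Real.log (1 + (μ / ν) * (x / Real.sqrt N)) - (μ / ν) * (x / Real.sqrt N))
          ≤ 0 := mul_nonpos_of_nonneg_of_nonpos (Nat.cast_nonneg _) (by linarith)
      have t3 : x * (δ N / ν + (Real.sqrt N)⁻¹) ≤ x := mul_le_of_le_one_right hx0.le hA.le
      have t4 : 0 ≤ 2 / μ - x + μ / 8 * x ^ 2 := by
        have : 2 / μ - x + μ / 8 * x ^ 2 = μ / 8 * (x - 4 / μ) ^ 2 := by
          field_simp; ring
        rw [this]; positivity
      linarith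
    · simp only [hF, Set.indicator_of_notMem hx, norm_zero]
      positivity
  -- pointwise limit
  have hlim : ∀ᵐ x : ℝ, Tendsto (fun N => F N x) atTop
      (𝓝 ((Set.Ioi (0:ℝ)).indicator (fun x => Real.exp (-(μ / ν / 2) * x ^ 2)) x)) := by
    refine Eventually.of_forall fun x => ?_
    by_cases hx : 0 < x
    · rw [Set.indicator_of_mem (show x ∈ Set.Ioi (0:ℝ) from hx)]
      have hL1 := (aux_log_limit x).comp hs
      have hL2 := (aux_log_limit (-(μ / ν * x))).comp hs
      have hc1 : Tendsto (fun N : ℕ => μ - δ N * (Real.sqrt N)⁻¹ - (Real.sqrt N)⁻¹ ^ 2)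
          atTop (𝓝 μ) := by
        simpa using (tendsto_const_nhds.sub (hδ0.mul hsi) :
          Tendsto (fun N : ℕ => μ - δ N * (Real.sqrt N)⁻¹) atTop _).sub (hsi.pow 2)
      have hc2 : Tendsto (fun N : ℕ => ν + δ N * (Real.sqrt N)⁻¹) atTop (𝓝 ν) := by
        simpa using (tendsto_const_nhds.add (hδ0.mul hsi) :
          Tendsto (fun N : ℕ => ν + δ N * (Real.sqrt N)⁻¹) atTop _)
      have hA : Tendsto (fun N : ℕ => x * (δ N / ν + (Real.sqrt N)⁻¹)) atTop (𝓝 0) := by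
        simpa using ((hδ0.div_const ν).add hsi).const_mul x
      have hP : Tendsto (fun N : ℕ => αN N * Real.log x - αN N * Real.log (Real.sqrt N))
          atTop (𝓝 0) := by
        simpa using (hαlim.mul_const (Real.log x)).sub hαlog
      have hT := ((((hc1.mul hL1).add (hc2.mul hL2)).add hA).add hP)
      have hval : μ * -(x ^ 2 / 2) + ν * -((-(μ / ν * x)) ^ 2 / 2) + 0 + 0
          = -(μ / ν / 2) * x ^ 2 := by
        have : μ = 1 - ν := hμ
        subst this
        field_simp
        ring
      rw [hval] at hT
      refine (Real.continuous_exp.continuousAt.tendsto.comp hT).congr' ?_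
      filter_upwards [hbasic, hGexp, hs.eventually_gt_atTop x] with N hN hE hxs
      obtain ⟨h1, h2, h3⟩ := hN
      have hmem : x / Real.sqrt N ∈ Set.Ioo (0:ℝ) 1 := ⟨by positivity, (div_lt_one h1).2 hxs⟩
      simp only [hF, Set.indicator_of_mem hmem, hG]
      rw [hE x hmem, Real.rpow_def_of_pos hmem.1, ← Real.exp_add, Real.log_div hx.ne' h1.ne']
      simp only [Function.comp]
      congr 1
      rw [show 1 - -(μ / ν * x) / Real.sqrt N = 1 + (μ / ν) * (x / Real.sqrt N) by ring, h2, h3]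
      have f1 : ∀ y, (μ - δ N * (Real.sqrt N)⁻¹ - (Real.sqrt N)⁻¹ ^ 2) * (Real.sqrt N ^ 2 * y)
          = (μ * Real.sqrt N ^ 2 - δ N * Real.sqrt N - 1) * y := fun y => by field_simp
      have f2 : ∀ y, (ν + δ N * (Real.sqrt N)⁻¹) * (Real.sqrt N ^ 2 * y)
          = (ν * Real.sqrt N ^ 2 + δ N * Real.sqrt N) * y := fun y => by field_simp
      rw [f1, f2]
      ring
    · rw [Set.indicator_of_notMem (show x ∉ Set.Ioi (0:ℝ) from hx)]
      refine tendsto_const_nhds.congr fun N => ?_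
      have : x / Real.sqrt N ∉ Set.Ioo (0:ℝ) 1 := fun h =>
        absurd h.1 (not_lt.2 (div_nonpos_of_nonpos_of_nonneg (not_lt.1 hx) (Real.sqrt_nonneg _)))
      simp only [hF, Set.indicator_of_notMem this]
  have hmeas : ∀ᶠ N : ℕ in atTop, AEStronglyMeasurable (F N) volume := by
    refine Eventually.of_forall fun N => Measurable.aestronglyMeasurable ?_
    have hGm : Measurable (G N) := by
      simp only [hG]; fun_prop
    exact (hGm.indicator measurableSet_Ioo).comp (measurable_id.div_const _)
  have hint : Integrable (fun x : ℝ => Real.exp (2 / μ) * Real.exp (-(μ / 8) * x ^ 2)) :=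
    (integrable_exp_neg_mul_sq (by positivity)).const_mul _
  have key := (tendsto_integral_filter_of_dominated_convergence _ hmeas hbound hint hlim).const_mul μ
  rw [integral_indicator measurableSet_Ioi, integral_gaussian_Ioi] at key
  have hfin : μ * (Real.sqrt (Real.pi / (μ / ν / 2)) / 2)
      = Real.sqrt (Real.pi * ν * (1 - ν) / 2) := by
    rw [← hμ]
    have : μ * (Real.sqrt (Real.pi / (μ / ν / 2)) / 2)
        = (μ / 2) * Real.sqrt (Real.pi / (μ / ν / 2)) := by ring
    rw [this]
    symm
    rw [Real.sqrt_eq_iff_mul_self_eq (by positivity) (by positivity), mul_mul_mul_comm,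
      Real.mul_self_sqrt (by positivity)]
    field_simp
  rw [hfin] at key
  refine key.congr fun N => ?_
  simp only [hF]
  rw [Measure.integral_comp_div (fun y => (Set.Ioo (0:ℝ) 1).indicator (G N) y),
    integral_indicator measurableSet_Ioo, abs_of_nonneg (Real.sqrt_nonneg _), smul_eq_mul]
  ring
end
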